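/- Consider the switched system ẋ = f(t, x, σ(t)) on ℝ² with three modes f₁(t,ξ) = (−g₁(t,ξ)ξ₂, g₁(t,ξ)ξ₁ − ξ₂), f₂(t,ξ) = (g₂(t,ξ)ξ₂ − ξ₁, −g₂(t,ξ)ξ₁) and f₃(t,ξ) = (2g₂(t,ξ)ξ₂ − ξ₁, −2g₂(t,ξ)ξ₁), where g₁, g₂ : ℝ≥0 × ℝ² → ℝ are uniformly bounded, measurable in t and continuous in ξ uniformly in t, and where for i = 1,2 the functions ĝ_i(t,v) := g_i(t, v e_i) (e₁ = (1,0), e₂ = (0,1)) are precompact and satisfy: for each v₀ ∈ ℝ ∖ {0} there exist T = T(v₀) > 0 and r_i = r_i(v₀) > 0 with liminf_{t→∞} ∫_t^{t+T} |ĝ_i(s, v₀)|^{r_i} ds > 0. Then the switched system is GUAS under arbitrary switchings: there exists β ∈ 𝒦ℒ such that for every trajectory (x,σ) and every s ∈ [t₀(x), t_f(x)), |x(t)| ≤ β(|x(s)|, t−s) for all s ≤ t < t_f(x). -/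

import Mathlib

open MeasureTheory Filter Set Topology

noncomputable section

namespace SwitchedSys

/-- Euclidean state space ℝⁿ. -/
abbrev E (n : ℕ) := EuclideanSpace ℝ (Fin n)

/-! ### Comparison function classes -/

/-- Class 𝒦 functions (on [0,∞)). -/
def ClassK (α : ℝ → ℝ) : Prop :=
  ContinuousOn α (Ici 0) ∧ StrictMonoOn α (Ici 0) ∧ α 0 = 0

/-- Class 𝒦∞ functions. -/
def ClassKInf (α : ℝ → ℝ) : Prop :=
  ClassK α ∧ Tendsto α atTop atTop

/-- Class 𝒦ℒ functions. -/
def ClassKL (β : ℝ → ℝ → ℝ) : Prop :=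
  (∀ t, 0 ≤ t → ClassKInf fun r => β r t) ∧
  ∀ r, 0 ≤ r → AntitoneOn (fun t => β r t) (Ici 0) ∧
    Tendsto (fun t => β r t) atTop (nhds 0)

/-! ### Switching signals, controls and weak convergence -/

/-- A switching signal: piecewise constant and continuous from the right, with at most
finitely many jumps in each compact interval. -/
def IsSwitchingSignal {N : ℕ} (σ : ℝ → Fin N) : Prop :=
  ∀ a b : ℝ, a < b → ∃ (k : ℕ) (τ : ℕ → ℝ), τ 0 = a ∧ τ k = b ∧
    (∀ j, j < k → τ j < τ (j + 1)) ∧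
    ∀ j, j < k → ∀ s ∈ Ico (τ j) (τ (j + 1)), σ s = σ (τ j)

/-- The standard simplex U ⊆ ℝᴺ. -/
def simplexU (N : ℕ) : Set (Fin N → ℝ) := {μ | (∀ i, 0 ≤ μ i) ∧ ∑ i, μ i = 1}

/-- The set 𝒰 of admissible controls: measurable functions with values in the simplex. -/
def IsControl {N : ℕ} (u : ℝ → Fin N → ℝ) : Prop :=
  Measurable u ∧ ∀ t, u t ∈ simplexU N

/-- The i-th canonical basis vector of ℝᴺ. -/
def stdVec (N : ℕ) (i : Fin N) : Fin N → ℝ := fun j => if j = i then 1 else 0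

/-- The control u_σ = e_{σ(·)} associated with a switching signal σ. -/
def ctrlOfSwitch {N : ℕ} (σ : ℝ → Fin N) : ℝ → Fin N → ℝ := fun t => stdVec N (σ t)

/-- Weak convergence u_k ⇀ v, tested against all f ∈ L¹(ℝ,ℝᴺ). -/
def WeakConv {N : ℕ} (u : ℕ → ℝ → Fin N → ℝ) (v : ℝ → Fin N → ℝ) : Prop :=
  ∀ g : ℝ → Fin N → ℝ, Integrable g volume →
    Tendsto (fun k => ∫ t : ℝ, ∑ i, g t i * u k t i)
      atTop (nhds (∫ t : ℝ, ∑ i, g t i * v t i))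

/-! ### Regularity notions for time-varying maps -/

/-- g(t,ξ) is uniformly bounded: bounded on J′ × K for each compact K ⊆ 𝒳,
where J′ ⊆ [0,∞) has full measure. -/
def UnifBounded {X F : Type*} [TopologicalSpace X] [NormedAddCommGroup F]
    (𝒳 : Set X) (g : ℝ → X → F) : Prop :=
  ∃ J' ⊆ Ici (0:ℝ), volume (Ici (0:ℝ) \ J') = 0 ∧
    ∀ K : Set X, IsCompact K → K ⊆ 𝒳 → ∃ C : ℝ, ∀ t ∈ J', ∀ ξ ∈ K, ‖g t ξ‖ ≤ C

/-- g(t,ξ) is continuous in ξ uniformly in t (via a class 𝒦 modulus of continuity on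
each compact subset of 𝒳). -/
def ContXiUnifT {X F : Type*} [NormedAddCommGroup X] [NormedAddCommGroup F]
    (𝒳 : Set X) (g : ℝ → X → F) : Prop :=
  ∃ J' ⊆ Ici (0:ℝ), volume (Ici (0:ℝ) \ J') = 0 ∧
    ∀ K : Set X, IsCompact K → K ⊆ 𝒳 → ∃ ω : ℝ → ℝ, ClassK ω ∧
      ∀ t ∈ J', ∀ ξ ∈ K, ∀ ζ ∈ K, ‖g t ξ - g t ζ‖ ≤ ω ‖ξ - ζ‖

/-- g(t,ξ) is locally Lipschitz in ξ uniformly in t. -/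
def LipXiUnifT {X F : Type*} [NormedAddCommGroup X] [NormedAddCommGroup F]
    (𝒳 : Set X) (g : ℝ → X → F) : Prop :=
  ∃ J' ⊆ Ici (0:ℝ), volume (Ici (0:ℝ) \ J') = 0 ∧
    ∀ K : Set X, IsCompact K → K ⊆ 𝒳 → ∃ L : ℝ, 0 ≤ L ∧
      ∀ t ∈ J', ∀ ξ ∈ K, ∀ ζ ∈ K, ‖g t ξ - g t ζ‖ ≤ L * ‖ξ - ζ‖

/-- gγ is the limiting function of g along the sequence γ = {t_k}: g(t_k+s,ξ) → gγ(s,ξ)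
for all ξ ∈ 𝒳 and all s outside a Lebesgue-null set. -/
def IsLimitAlong {X F : Type*} [TopologicalSpace F]
    (𝒳 : Set X) (g : ℝ → X → F) (γ : ℕ → ℝ) (glim : ℝ → X → F) : Prop :=
  ∃ Eγ : Set ℝ, volume Eγ = 0 ∧ ∀ ξ ∈ 𝒳, ∀ s : ℝ, s ∉ Eγ →
    Tendsto (fun k => g (γ k + s) ξ) atTop (nhds (glim s ξ))

/-- γ is an admissible sequence for g. -/
def Admissible {X F : Type*} [TopologicalSpace F]
    (𝒳 : Set X) (g : ℝ → X → F) (γ : ℕ → ℝ) : Prop :=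
  Tendsto γ atTop atTop ∧ ∃ glim : ℝ → X → F, IsLimitAlong 𝒳 g γ glim

/-- g is precompact: every sequence t_k → ∞ has an admissible subsequence. -/
def Precompact {X F : Type*} [TopologicalSpace F]
    (𝒳 : Set X) (g : ℝ → X → F) : Prop :=
  ∀ t : ℕ → ℝ, Tendsto t atTop atTop →
    ∃ φ : ℕ → ℕ, StrictMono φ ∧ Admissible 𝒳 g (t ∘ φ)

/-- (g, gh) is a zeroing pair. -/
def ZeroingPair {X F G : Type*} [NormedAddCommGroup X] [NormedAddCommGroup F]
    [NormedAddCommGroup G] (𝒳 : Set X) (g : ℝ → X → F) (gh : ℝ → X → G) : Prop :=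
  ∀ t : ℕ → ℝ, Tendsto t atTop atTop → ∀ K : Set X, IsCompact K → K ⊆ 𝒳 →
    ∀ ε : ℝ, 0 < ε → ∀ v : ℕ → X, (∀ k, v k ∈ K) → (∀ k, ε ≤ ‖v k‖) →
      Tendsto (fun k => g (t k) (v k)) atTop (nhds 0) →
      Tendsto (fun k => gh (t k) (v k)) atTop (nhds 0)

/-- Carathéodory conditions for a time-varying vector field on 𝒳. -/
def Caratheodory {n : ℕ} (𝒳 : Set (E n)) (g : ℝ → E n → E n) : Prop :=
  (∀ ξ ∈ 𝒳, Measurable fun t => g t ξ) ∧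
  (∀ᵐ t ∂volume.restrict (Ici (0:ℝ)), ContinuousOn (fun ξ => g t ξ) 𝒳) ∧
  ∀ K : Set (E n), IsCompact K → K ⊆ 𝒳 →
    ∃ m : ℝ → ℝ, (∀ a b : ℝ, IntervalIntegrable m volume a b) ∧
      ∀ᵐ t ∂volume.restrict (Ici (0:ℝ)), ∀ ξ ∈ K, ‖g t ξ‖ ≤ m t

/-! ### Solutions and trajectories of the switched system -/

/-- A (forward) solution of ẋ = f(t,x,σ(t)) on [t0, tf), encoded through the equivalent
integral equation (x is locally absolutely continuous with ẋ(t) = f(t,x(t),σ(t)) a.e.). -/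
structure Sol {n N : ℕ} (𝒳 : Set (E n)) (f : ℝ → E n → Fin N → E n) where
  x : ℝ → E n
  σ : ℝ → Fin N
  t0 : ℝ
  tf : EReal
  t0_nonneg : 0 ≤ t0
  t0_lt_tf : (t0 : EReal) < tf
  switching : IsSwitchingSignal σ
  mem : ∀ t : ℝ, t0 ≤ t → (t : EReal) < tf → x t ∈ 𝒳
  intg : ∀ a b : ℝ, t0 ≤ a → a ≤ b → (b : EReal) < tf →
    IntervalIntegrable (fun τ => f τ (x τ) (σ τ)) volume a b
  sol : ∀ a b : ℝ, t0 ≤ a → a ≤ b → (b : EReal) < tf →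
    x b = x a + ∫ τ in a..b, f τ (x τ) (σ τ)

variable {n N : ℕ} {𝒳 : Set (E n)} {f : ℝ → E n → Fin N → E n}

/-- t belongs to the domain [t0, tf) of the solution. -/
def Sol.InDom (T : Sol 𝒳 f) (t : ℝ) : Prop := T.t0 ≤ t ∧ (t : EReal) < T.tf

/-- A solution is maximal if it admits no proper extension (a trajectory is a maximal
solution together with its switching signal). -/
def Sol.IsMaximal (T : Sol 𝒳 f) : Prop :=
  ¬ ∃ T' : Sol 𝒳 f, T'.σ = T.σ ∧ T'.t0 = T.t0 ∧ T.tf < T'.tf ∧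
    ∀ t : ℝ, T.InDom t → T'.x t = T.x t

/-! ### Stability notions -/

/-- Uniform stability of a family of trajectories. -/
def US (𝒯 : Set (Sol 𝒳 f)) : Prop :=
  ∃ α : ℝ → ℝ, ∃ δ₀ : ℝ, ClassK α ∧ 0 < δ₀ ∧
    ∀ T ∈ 𝒯, ∀ s : ℝ, T.InDom s → ‖T.x s‖ ≤ δ₀ →
      ∀ t : ℝ, s ≤ t → (t : EReal) < T.tf → ‖T.x t‖ ≤ α ‖T.x s‖

/-- Global uniform stability of a family of trajectories. -/
def GUS (𝒯 : Set (Sol 𝒳 f)) : Prop :=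
  𝒳 = Set.univ ∧ ∃ α : ℝ → ℝ, ClassKInf α ∧
    ∀ T ∈ 𝒯, ∀ s : ℝ, T.InDom s →
      ∀ t : ℝ, s ≤ t → (t : EReal) < T.tf → ‖T.x t‖ ≤ α ‖T.x s‖

/-- Uniform asymptotic stability of a family of trajectories. -/
def UAS (𝒯 : Set (Sol 𝒳 f)) : Prop :=
  ∃ β : ℝ → ℝ → ℝ, ∃ δ₀ : ℝ, ClassKL β ∧ 0 < δ₀ ∧
    ∀ T ∈ 𝒯, ∀ s : ℝ, T.InDom s → ‖T.x s‖ < δ₀ →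
      ∀ t : ℝ, s ≤ t → (t : EReal) < T.tf → ‖T.x t‖ ≤ β ‖T.x s‖ (t - s)

/-- Global uniform asymptotic stability of a family of trajectories. -/
def GUAS (𝒯 : Set (Sol 𝒳 f)) : Prop :=
  𝒳 = Set.univ ∧ ∃ β : ℝ → ℝ → ℝ, ClassKL β ∧
    ∀ T ∈ 𝒯, ∀ s : ℝ, T.InDom s →
      ∀ t : ℝ, s ≤ t → (t : EReal) < T.tf → ‖T.x t‖ ≤ β ‖T.x s‖ (t - s)

/-! ### Output maps, zeroing-output sequences and WZSD -/

/-- A 𝒯-zeroing-output sequence for the switched system with output map h. -/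
def ZeroingOutputSeq {F : Type*} [NormedAddCommGroup F]
    (𝒯 : Set (Sol 𝒳 f)) (h : ℝ → E n → Fin N → F)
    (t : ℕ → ℝ) (T : ℕ → Sol 𝒳 f) : Prop :=
  Tendsto t atTop atTop ∧ (∀ k, T k ∈ 𝒯) ∧
  (∀ k : ℕ, (T k).t0 ≤ t k - k ∧ ((t k + k : ℝ) : EReal) < (T k).tf) ∧
  (∃ K : Set (E n), IsCompact K ∧ K ⊆ 𝒳 ∧ ∃ ε : ℝ, 0 < ε ∧
    ∀ k : ℕ, ∀ s : ℝ, |s| ≤ (k : ℝ) →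
      (T k).x (t k + s) ∈ K ∧ ε ≤ ‖(T k).x (t k + s)‖) ∧
  ∀ᵐ s : ℝ, Tendsto (fun k => h (t k + s) ((T k).x (t k + s)) ((T k).σ (t k + s)))
    atTop (nhds 0)

/-- The pair (h,f) is weakly zero-state detectable with respect to 𝒯:
there is no 𝒯-zeroing-output sequence. -/
def WZSD {F : Type*} [NormedAddCommGroup F]
    (𝒯 : Set (Sol 𝒳 f)) (h : ℝ → E n → Fin N → F) : Prop :=
  ¬ ∃ (t : ℕ → ℝ) (T : ℕ → Sol 𝒳 f), ZeroingOutputSeq 𝒯 h t T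

/-- Assumption 1: integral bound for the output along trajectories of 𝒯. -/
def IntegralOutputBound {F : Type*} [NormedAddCommGroup F]
    (𝒯 : Set (Sol 𝒳 f)) (h : ℝ → E n → Fin N → F) : Prop :=
  ∃ α : ℝ → ℝ, ContinuousOn α (Ici 0) ∧ α 0 = 0 ∧ (∀ r : ℝ, 0 < r → 0 < α r) ∧
    ∀ K : Set (E n), IsCompact K → K ⊆ 𝒳 → ∀ μ : ℝ, 0 < μ → ∃ M : ℝ, 0 < M ∧
      ∀ T ∈ 𝒯, ∀ s t : ℝ, T.t0 ≤ s → s < t → (t : EReal) < T.tf →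
        (∀ τ ∈ Icc s t, T.x τ ∈ K) →
        ∫ τ in s..t, α ‖h τ (T.x τ) (T.σ τ)‖ ≤ M + μ * (t - s)

/-! ### Coverings, limiting trajectories and reduced limiting control systems -/

/-- The set U_ξ = co{e_i : ξ ∈ χ_i} of control values compatible with the covering χ at ξ. -/
def Uset {N n : ℕ} (χ : Fin N → Set (E n)) (ξ : E n) : Set (Fin N → ℝ) :=
  convexHull ℝ {v : Fin N → ℝ | ∃ i, ξ ∈ χ i ∧ v = stdVec N i}

/-- 𝒯 is invariant with respect to the covering χ: x(t) ∈ χ_{σ(t)} along trajectories. -/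
def InvariantWrt (𝒯 : Set (Sol 𝒳 f)) (χ : Fin N → Set (E n)) : Prop :=
  ∀ T ∈ 𝒯, ∀ t : ℝ, T.InDom t → T.x t ∈ χ (T.σ t)

/-- The set 𝒮*_𝒯 of controls that are weak limits of time-translations of switching
signals of trajectories in 𝒯. -/
def SStar (𝒯 : Set (Sol 𝒳 f)) (u : ℝ → Fin N → ℝ) : Prop :=
  IsControl u ∧ ∃ (t : ℕ → ℝ) (T : ℕ → Sol 𝒳 f),
    Tendsto t atTop atTop ∧ (∀ k, T k ∈ 𝒯) ∧
    WeakConv (fun k s => ctrlOfSwitch (T k).σ (t k + s)) u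

/-- Limiting trajectory of the family 𝒯. -/
def LimitingTrajectory (𝒯 : Set (Sol 𝒳 f)) (xb : ℝ → E n) (ub : ℝ → Fin N → ℝ) : Prop :=
  Continuous xb ∧ (∀ t, xb t ∈ 𝒳) ∧ IsControl ub ∧
  ∃ (t : ℕ → ℝ) (T : ℕ → Sol 𝒳 f) (K : Set (E n)),
    Tendsto t atTop atTop ∧ (∀ k, T k ∈ 𝒯) ∧ IsCompact K ∧ K ⊆ 𝒳 ∧
    (∀ k : ℕ, (T k).t0 ≤ t k - k ∧ ((t k + k : ℝ) : EReal) < (T k).tf) ∧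
    (∀ k : ℕ, ∀ s : ℝ, |s| ≤ (k : ℝ) → (T k).x (t k + s) ∈ K) ∧
    (∀ Tc : ℝ, 0 < Tc →
      TendstoUniformlyOn (fun k s => (T k).x (t k + s)) xb atTop (Icc (-Tc) Tc)) ∧
    WeakConv (fun k s => ctrlOfSwitch (T k).σ (t k + s)) ub

/-- 𝒯-zeroing-output limiting trajectory. -/
def ZeroingOutputLimitingTrajectory {F : Type*} [NormedAddCommGroup F]
    (𝒯 : Set (Sol 𝒳 f)) (h : ℝ → E n → Fin N → F)
    (xb : ℝ → E n) (ub : ℝ → Fin N → ℝ) : Prop :=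
  Continuous xb ∧ (∀ t, xb t ∈ 𝒳) ∧ IsControl ub ∧
  ∃ (t : ℕ → ℝ) (T : ℕ → Sol 𝒳 f), ZeroingOutputSeq 𝒯 h t T ∧
    (∀ Tc : ℝ, 0 < Tc →
      TendstoUniformlyOn (fun k s => (T k).x (t k + s)) xb atTop (Icc (-Tc) Tc)) ∧
    WeakConv (fun k s => ctrlOfSwitch (T k).σ (t k + s)) ub

/-- Locally absolutely continuous function on ℝ (indefinite integral of a locally
integrable function). -/
def LocAC {V : Type*} [NormedAddCommGroup V] [NormedSpace ℝ V] (x : ℝ → V) : Prop :=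
  ∃ g : ℝ → V, (∀ a b : ℝ, IntervalIntegrable g volume a b) ∧
    ∀ t : ℝ, x t = x 0 + ∫ s in (0:ℝ)..t, g s

/-- A complete trajectory of the reduced limiting control system Σ_γ determined by the
limiting functions fl = (f̂_{i,γ}) and hl = (h_{i,γ}), the covering χ and the constraint
u ∈ 𝒮*_𝒯: x is locally absolutely continuous and, for a.e. t, u(t) ∈ U_{x(t)},
x′(t) = Σ_i u_i(t) f̂_{i,γ}(t,x(t)) and Σ_i u_i(t) |h_{i,γ}(t,x(t))| = 0. -/
def CompleteTrajOf {F : Type*} [NormedAddCommGroup F]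
    (𝒯 : Set (Sol 𝒳 f)) (χ : Fin N → Set (E n))
    (fl : Fin N → ℝ → E n → E n) (hl : Fin N → ℝ → E n → F)
    (x : ℝ → E n) (u : ℝ → Fin N → ℝ) : Prop :=
  (∀ t, x t ∈ 𝒳) ∧ LocAC x ∧ SStar 𝒯 u ∧
  ∀ᵐ t : ℝ, u t ∈ Uset χ (x t) ∧
    HasDerivAt x (∑ i, u t i • fl i t (x t)) t ∧
    ∑ i, u t i * ‖hl i t (x t)‖ = 0

/-- A bounded complete trajectory: the state stays in a compact subset of 𝒳. -/
def BoundedRange (𝒳 : Set (E n)) (x : ℝ → E n) : Prop :=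
  ∃ K : Set (E n), IsCompact K ∧ K ⊆ 𝒳 ∧ ∀ t : ℝ, x t ∈ K

end SwitchedSys

open SwitchedSys Filter Set MeasureTheory

/-- `p` is a primitive of `P` on `[a,b]`. -/
def Prim (p P : ℝ → ℝ) (a b : ℝ) : Prop :=
  IntervalIntegrable P volume a b ∧ ∀ s ∈ Icc a b, p s = p a + ∫ τ in a..s, P τ

lemma Prim.sub {p P : ℝ → ℝ} {a b c d : ℝ} (h : Prim p P a b) (hac : a ≤ c) (hcd : c ≤ d)
    (hdb : d ≤ b) : Prim p P c d := by
  have hi : ∀ x ∈ Icc a b, ∀ y ∈ Icc a b, IntervalIntegrable P volume x y := by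
    intro x hx y hy
    apply h.1.mono_set
    rw [uIcc_of_le (a := a) (b := b) (hx.1.trans hx.2)]
    exact uIcc_subset_Icc hx hy
  refine ⟨hi c ⟨hac, hcd.trans hdb⟩ d ⟨hac.trans hcd, hdb⟩, fun s hs => ?_⟩
  have hs' : s ∈ Icc a b := ⟨hac.trans hs.1, hs.2.trans hdb⟩
  have hc' : c ∈ Icc a b := ⟨hac, hcd.trans hdb⟩
  have ha' : a ∈ Icc a b := ⟨le_rfl, hs'.1.trans hs'.2⟩
  rw [h.2 s hs', h.2 c hc', ← intervalIntegral.integral_add_adjacent_intervals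
    (hi a ha' c hc') (hi c hc' s hs')]
  ring

lemma Prim.contOn {p P : ℝ → ℝ} {a b : ℝ} (h : Prim p P a b) : ContinuousOn p (Icc a b) := by
  by_cases hab : a ≤ b
  · have h1 := intervalIntegral.continuousOn_primitive_interval' h.1 (left_mem_uIcc)
    rw [uIcc_of_le hab] at h1
    exact (continuousOn_const.add h1).congr h.2
  · rw [Icc_eq_empty hab]; exact continuousOn_empty _

lemma Prim.eq {p P : ℝ → ℝ} {a b : ℝ} (h : Prim p P a b) (hab : a ≤ b) :
    p b - p a = ∫ τ in a..b, P τ := by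
  rw [h.2 b ⟨hab, le_rfl⟩]; ring

lemma Prim.sq_eq {p P : ℝ → ℝ} {a b : ℝ} (h : Prim p P a b) (hab : a ≤ b) :
    p b ^ 2 - p a ^ 2 = ∫ τ in a..b, 2 * (p τ * P τ) := by
  have h1 := h.1.absolutelyContinuousOnInterval_intervalIntegral (c := a) left_mem_uIcc
  have h0 : AbsolutelyContinuousOnInterval (fun _ : ℝ => p a) a b :=
    ContDiffOn.absolutelyContinuousOnInterval contDiffOn_const
  have h2 := h0.fun_add h1
  have h3 := h2.integral_deriv_mul_eq_sub h2
  simp only [← h.2 b ⟨hab, le_rfl⟩, intervalIntegral.integral_same, add_zero] at h3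
  have h4 : p b ^ 2 - p a ^ 2 = p b * p b - p a * p a := by ring
  rw [h4, ← h3]
  apply intervalIntegral.integral_congr_ae
  filter_upwards [h.1.ae_hasDerivAt_integral] with x hx hx2
  have hx3 : x ∈ uIcc a b := uIoc_subset_uIcc hx2
  have hd := (hx hx3 a left_mem_uIcc).const_add (p a)
  rw [hd.deriv]
  rw [uIcc_of_le hab] at hx3
  rw [← h.2 x hx3]; ring

lemma Prim.mulInt {p P : ℝ → ℝ} {a b : ℝ} (h : Prim p P a b) (hab : a ≤ b) :
    IntervalIntegrable (fun τ => 2 * (p τ * P τ)) volume a b := by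
  have := h.1.continuousOn_mul (g := p) (by rw [uIcc_of_le hab]; exact h.contOn)
  exact this.const_mul 2

/-- integral bound, for a.e.-bounds -/
lemma abs_int_le {w e : ℝ → ℝ} {a b c d : ℝ} (hac : a ≤ c) (hcd : c ≤ d)
    (hdb : d ≤ b) (he : IntervalIntegrable e volume a b)
    (hb : ∀ᵐ s, s ∈ Ioc a b → |w s| ≤ e s) :
    |∫ s in c..d, w s| ≤ ∫ s in a..b, e s := by
  have h1 : ∀ᵐ s ∂(volume.restrict (Ioc a b)), 0 ≤ e s := by
    rw [ae_restrict_iff' measurableSet_Ioc]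
    filter_upwards [hb] with s hs h using (abs_nonneg _).trans (hs h)
  calc |∫ s in c..d, w s| ≤ ∫ s in c..d, e s := by
        rw [← Real.norm_eq_abs]
        apply intervalIntegral.norm_integral_le_of_norm_le hcd
        · filter_upwards [hb] with s hs h
          exact hs ⟨hac.trans_lt h.1, h.2.trans hdb⟩
        · exact he.mono_set (by
            rw [uIcc_of_le hcd, uIcc_of_le (hac.trans (hcd.trans hdb))]
            exact Icc_subset_Icc hac hdb)
    _ ≤ ∫ s in a..b, e s := by
        apply intervalIntegral.integral_mono_interval hac hcd hdb h1 he
lemma var_bound {p P e : ℝ → ℝ} {L B : ℝ} (hp : Prim p P 0 L)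
    (he : IntervalIntegrable e volume 0 L) (hB : ∫ s in (0:ℝ)..L, e s ≤ B)
    (hb : ∀ᵐ s, s ∈ Ioc 0 L → |P s| ≤ e s) :
    ∀ s ∈ Icc 0 L, ∀ s' ∈ Icc 0 L, |p s - p s'| ≤ B := by
  have key : ∀ c d : ℝ, 0 ≤ c → c ≤ d → d ≤ L → |p d - p c| ≤ B := by
    intro c d hc hcd hd
    rw [(hp.sub hc hcd hd).eq hcd]
    exact (abs_int_le hc hcd hd he hb).trans hB
  intro s hs s' hs'
  rcases le_total s' s with h | h
  · exact key _ _ hs'.1 h hs.2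
  · rw [abs_sub_comm]; exact key _ _ hs.1 h hs'.2

lemma var_bound_sq {p P e : ℝ → ℝ} {L B : ℝ} (hp : Prim p P 0 L)
    (he : IntervalIntegrable e volume 0 L) (hB : ∫ s in (0:ℝ)..L, e s ≤ B)
    (hb : ∀ᵐ s, s ∈ Ioc 0 L → |2 * (p s * P s)| ≤ e s) :
    ∀ s ∈ Icc 0 L, ∀ s' ∈ Icc 0 L, |p s ^ 2 - p s' ^ 2| ≤ B := by
  have key : ∀ c d : ℝ, 0 ≤ c → c ≤ d → d ≤ L → |p d ^ 2 - p c ^ 2| ≤ B := by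
    intro c d hc hcd hd
    rw [(hp.sub hc hcd hd).sq_eq hcd]
    exact (abs_int_le hc hcd hd he hb).trans hB
  intro s hs s' hs'
  rcases le_total s' s with h | h
  · exact key _ _ hs'.1 h hs.2
  · rw [abs_sub_comm]; exact key _ _ hs.1 h hs'.2

lemma abs_le_young {z κ : ℝ} (hκ : 0 < κ) : |z| ≤ κ + z ^ 2 / κ := by
  have h : κ * |z| ≤ κ * (κ + z ^ 2 / κ) := by
    have : κ * (κ + z ^ 2 / κ) = κ ^ 2 + z ^ 2 := by field_simp
    rw [this, ← sq_abs z]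
    nlinarith [sq_nonneg (κ - |z|), abs_nonneg z]
  exact le_of_mul_le_mul_left h hκ

lemma core_bounds {L R C κ ε : ℝ} {p q P y2 : ℝ → ℝ} (hR : 0 < R) (hC : 1 ≤ C)
    (hκ : 0 < κ) (hκ1 : κ ≤ 1) (hε : 0 < ε)
    (hp : Prim p P 0 L) (hy : IntervalIntegrable y2 volume 0 L)
    (hyκ : ∫ s in (0:ℝ)..L, y2 s ≤ κ ^ 2)
    (hVR : ∀ s ∈ Icc 0 L, p s ^ 2 + q s ^ 2 ≤ R ^ 2)
    (hVε : ∀ s ∈ Icc 0 L, ε ^ 2 ≤ p s ^ 2 + q s ^ 2)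
    (hVd : ∀ s ∈ Icc 0 L, ∀ s' ∈ Icc 0 L, p s ^ 2 + q s ^ 2 ≤ p s' ^ 2 + q s' ^ 2 + κ ^ 2)
    (hm : ∀ᵐ s, s ∈ Ioc 0 L → (y2 s = q s ^ 2 ∧ |P s| ≤ 2 * C * |q s|) ∨
      (y2 s = p s ^ 2 ∧ |P s| ≤ 3 * C * R))
    {s0 : ℝ} (hs0 : s0 ∈ Icc 0 L) (hq0 : q s0 ^ 2 ≤ κ ^ 2)
    (hsm : (6 * C * R * (L + 1) + 1) * κ ≤ ε ^ 2 / 2) :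
    ∀ s ∈ Icc 0 L, (ε / 2) ≤ |p s| ∧ q s ^ 2 ≤ (6 * C * R * (L + 1) + 2) * κ ∧
      |p s - p s0| ≤ (2 * C + 6 * C * R / ε) * (L + 1) * κ := by
  have hItg : ∀ A : ℝ, IntervalIntegrable (fun s => A * (κ + y2 s / κ)) volume 0 L := fun A =>
    ((intervalIntegrable_const).add (hy.div_const κ)).const_mul A
  have hval : ∀ A : ℝ, 0 ≤ A → ∫ s in (0:ℝ)..L, A * (κ + y2 s / κ) ≤ A * (L + 1) * κ := by
    intro A hA
    rw [intervalIntegral.integral_const_mul, intervalIntegral.integral_add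
      intervalIntegrable_const (hy.div_const κ), intervalIntegral.integral_div,
      intervalIntegral.integral_const, mul_assoc]
    apply mul_le_mul_of_nonneg_left _ hA
    have : (∫ s in (0:ℝ)..L, y2 s) / κ ≤ κ := by
      rw [div_le_iff₀ hκ]; nlinarith
    simp only [smul_eq_mul]; linarith
  have hκ2 : κ ^ 2 ≤ κ := by nlinarith
  have hpR : ∀ s ∈ Icc 0 L, |p s| ≤ R := fun s hs =>
    abs_le_of_sq_le_sq (by nlinarith [hVR s hs, sq_nonneg (q s)]) hR.le
  have hCR : 0 < C * R := by positivity
  have hsq := var_bound_sq hp (hItg (6 * C * R)) (hval _ (by positivity)) (by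
    filter_upwards [hm] with s hs h
    have hs' : s ∈ Icc 0 L := ⟨h.1.le, h.2⟩
    have h1 := hpR s hs'
    rw [abs_mul, abs_mul, abs_two]
    rcases hs h with ⟨h2, h3⟩ | ⟨h2, h3⟩
    · have h4 := abs_le_young (z := q s) hκ
      rw [h2]
      calc 2 * (|p s| * |P s|) ≤ 2 * (R * (2 * C * |q s|)) := by gcongr
        _ ≤ 6 * C * R * |q s| := by nlinarith [mul_nonneg hCR.le (abs_nonneg (q s))]
        _ ≤ _ := by gcongr
    · have h4 := abs_le_young (z := p s) hκ
      rw [h2]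
      calc 2 * (|p s| * |P s|) ≤ 2 * (|p s| * (3 * C * R)) := by gcongr
        _ = 6 * C * R * |p s| := by ring
        _ ≤ _ := by gcongr)
  have hplow : ∀ s ∈ Icc 0 L, (ε / 2) ≤ |p s| := by
    intro s hs
    have h1 := abs_le.1 (hsq s hs s0 hs0)
    have h2 := hVε s0 hs0
    apply abs_le_of_sq_le_sq' _ (abs_nonneg _) |>.2
    rw [sq_abs]
    nlinarith
  intro s hs
  refine ⟨hplow s hs, ?_, ?_⟩
  · have h1 := abs_le.1 (hsq s hs s0 hs0)
    have h2 := hVd s hs s0 hs0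
    nlinarith
  · refine var_bound hp (hItg (2 * C + 6 * C * R / ε)) (hval _ (by positivity)) ?_ s hs s0 hs0
    filter_upwards [hm] with s hs h
    have hs' : s ∈ Icc 0 L := ⟨h.1.le, h.2⟩
    have h1 := hplow s hs'
    rcases hs h with ⟨h2, h3⟩ | ⟨h2, h3⟩
    · have h4 := abs_le_young (z := q s) hκ
      rw [h2]
      calc |P s| ≤ (2 * C + 0) * |q s| := by linarith
        _ ≤ _ := by gcongr; positivity
    · have h4 := abs_le_young (z := p s) hκ
      rw [h2]
      calc |P s| ≤ 3 * C * R := h3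
        _ = (0 + 6 * C * R / ε) * (ε / 2) := by field_simp; ring
        _ ≤ (2 * C + 6 * C * R / ε) * |p s| := by gcongr; positivity
        _ ≤ _ := by gcongr
/-- Uniform excitation property on a set of amplitudes. -/
def PEU (gh : ℝ → ℝ → ℝ) (S : Set ℝ) : Prop :=
  ∃ T0 : ℝ, 0 < T0 ∧ ∃ ρ : ℝ, 0 < ρ ∧ ∃ t' : ℝ, ∀ v ∈ S, ∀ t, t' ≤ t → ∀ L, T0 ≤ L →
    ∀ w e : ℝ → ℝ, IntervalIntegrable w volume 0 L → IntervalIntegrable e volume 0 L →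
    (∀ᵐ s, s ∈ Ioc 0 L → ∃ u ∈ Icc (1:ℝ) 2, |w s - u * gh (t + s) v| ≤ e s) →
    ∃ a b, 0 ≤ a ∧ a ≤ b ∧ b ≤ L ∧ ρ ≤ |∫ s in a..b, w s| + ∫ s in (0:ℝ)..L, e s

lemma lebesgue_point {h : ℝ → ℝ} {T : ℝ} (hi : IntegrableOn h (Ioc 0 T))
    (hne : ¬ ∀ᵐ s, s ∈ Ioc 0 T → h s = 0) :
    ∃ h0 : ℝ, h0 ≠ 0 ∧ ∃ a b, 0 < a ∧ a < b ∧ b < T ∧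
      ∫ s in a..b, |h s - h0| ≤ (b - a) * (|h0| / 8) := by
  have hItg : Integrable ((Ioc 0 T).indicator h) := (integrable_indicator_iff measurableSet_Ioc).2 hi
  have hleb := IsUnifLocDoublingMeasure.ae_tendsto_average_norm_sub (μ := volume)
    hItg.locallyIntegrable 1
  have hT0 : ∀ᵐ s : ℝ, s ≠ T := by simp [ae_iff, measure_singleton]
  have : ∃ s, s ∈ Ioo 0 T ∧ h s ≠ 0 ∧ Tendsto (fun j : ℕ => ⨍ y in Metric.closedBall s (1 / ((j:ℝ) + 1)),
      ‖(Ioc 0 T).indicator h y - (Ioc 0 T).indicator h s‖) atTop (𝓝 0) := by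
    by_contra hcon
    push Not at hcon
    apply hne
    filter_upwards [hleb, hT0] with s hs hsT hsI
    by_contra hz
    refine hcon s ⟨hsI.1, lt_of_le_of_ne hsI.2 hsT⟩ hz ?_
    apply hs
    · apply tendsto_nhdsWithin_iff.2 ⟨tendsto_one_div_add_atTop_nhds_zero_nat, ?_⟩
      exact Eventually.of_forall fun j => by simp only [mem_Ioi]; positivity
    · exact Eventually.of_forall fun j => by
        apply Metric.mem_closedBall_self; positivity
  obtain ⟨s, hs, hsn, hlim⟩ := this
  have e1 := hlim.eventually (gt_mem_nhds (show 0 < |h s| / 8 by positivity))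
  have e2 := (tendsto_one_div_add_atTop_nhds_zero_nat (𝕜 := ℝ)).eventually
    (gt_mem_nhds (show 0 < min s (T - s) from lt_min hs.1 (by linarith [hs.2])))
  obtain ⟨j, hj1, hj2⟩ := (e1.and e2).exists
  set d : ℝ := 1 / ((j:ℝ) + 1) with hd
  have hd0 : 0 < d := by positivity
  have hd1 := hj2.trans_le (min_le_left _ _)
  have hd2 := hj2.trans_le (min_le_right _ _)
  refine ⟨h s, hsn, s - d, s + d, by linarith, by linarith, by linarith, ?_⟩
  rw [Real.closedBall_eq_Icc, setAverage_eq, measureReal_def, Real.volume_Icc,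
    ENNReal.toReal_ofReal (by linarith)] at hj1
  rw [intervalIntegral.integral_of_le (by linarith), ← integral_Icc_eq_integral_Ioc]
  have hcg : ∫ y in Icc (s - d) (s + d), |h y - h s| =
      ∫ y in Icc (s - d) (s + d), ‖(Ioc 0 T).indicator h y - (Ioc 0 T).indicator h s‖ := by
    apply setIntegral_congr_fun measurableSet_Icc
    intro y hy
    simp only [Real.norm_eq_abs]
    rw [indicator_of_mem (show y ∈ Ioc 0 T from ⟨by linarith [hy.1], by linarith [hy.2]⟩),
      indicator_of_mem (show s ∈ Ioc 0 T from ⟨hs.1, hs.2.le⟩)]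
  rw [hcg]
  rw [smul_eq_mul, inv_mul_lt_iff₀ (by linarith)] at hj1
  exact hj1.le

lemma PE_single {gh : ℝ → ℝ → ℝ} {v₀ C : ℝ} (hmeas : Measurable fun t => gh t v₀)
    (hC : ∀ᵐ t : ℝ, 0 ≤ t → |gh t v₀| ≤ C)
    (hpre : Precompact (univ : Set ℝ) gh)
    (hPE : ∃ T : ℝ, 0 < T ∧ ∃ r : ℝ, 0 < r ∧
      0 < atTop.liminf fun t : ℝ => ∫ s in t..(t + T), |gh s v₀| ^ r) :
    PEU gh {v₀} := by
  obtain ⟨T, hT, r, hr, hlim⟩ := hPE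
  obtain ⟨c, hc0, hc⟩ := exists_between hlim
  have hev : ∀ᶠ t : ℝ in atTop, c < ∫ s in t..(t + T), |gh s v₀| ^ r := by
    refine eventually_lt_of_lt_liminf hc ⟨0, ?_⟩
    simp only [eventually_map]
    exact Eventually.of_forall fun t => intervalIntegral.integral_nonneg (by linarith)
      fun s _ => by positivity
  by_contra hcon
  have hcon' : ∀ k : ℕ, ∃ t : ℝ, (k:ℝ) ≤ t ∧ ∃ L, T ≤ L ∧ ∃ w e : ℝ → ℝ,
      IntervalIntegrable w volume 0 L ∧ IntervalIntegrable e volume 0 L ∧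
      (∀ᵐ s, s ∈ Ioc 0 L → ∃ u ∈ Icc (1:ℝ) 2, |w s - u * gh (t + s) v₀| ≤ e s) ∧
      ∀ a b, 0 ≤ a → a ≤ b → b ≤ L →
        |∫ s in a..b, w s| + ∫ s in (0:ℝ)..L, e s < 1 / ((k:ℝ) + 1) := by
    intro k
    by_contra hk
    push Not at hk
    apply hcon
    refine ⟨T, hT, 1 / ((k:ℝ) + 1), by positivity, k, ?_⟩
    rintro v rfl t ht L hL w e hw he hu
    obtain ⟨a, b, h1, h2, h3, h4⟩ := hk t ht L hL w e hw he hu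
    exact ⟨a, b, h1, h2, h3, h4⟩
  choose t ht L hL w e hw he hu hsmall using hcon'
  have httop : Tendsto t atTop atTop :=
    tendsto_atTop_mono ht tendsto_natCast_atTop_atTop
  obtain ⟨φ, hφ, hφtop, glim, Eγ, hE, hconv⟩ := hpre t httop
  set h : ℝ → ℝ := fun s => glim s v₀ with hh
  set G : ℕ → ℝ → ℝ := fun k s => gh (t (φ k) + s) v₀ with hG
  have hGm : ∀ k, Measurable (G k) := fun k => hmeas.comp (measurable_const_add _)
  have hae : ∀ᵐ s, Tendsto (fun k => G k s) atTop (𝓝 (h s)) := by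
    have : ∀ᵐ s, s ∉ Eγ := measure_eq_zero_iff_ae_notMem.1 hE
    filter_upwards [this] with s hs using hconv v₀ (mem_univ _) s hs
  have hGb : ∀ k, ∀ᵐ s, 0 ≤ s → |G k s| ≤ C := by
    intro k
    have := (measurePreserving_add_left volume (t (φ k))).quasiMeasurePreserving.ae hC
    filter_upwards [this] with s hs h0
    apply hs
    have h1 := ht (φ k)
    have h2 : (0:ℝ) ≤ (φ k : ℝ) := Nat.cast_nonneg _
    linarith
  have hGb' : ∀ᵐ s, ∀ k, 0 ≤ s → |G k s| ≤ C := ae_all_iff.2 hGb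
  have hhb : ∀ᵐ s, 0 ≤ s → |h s| ≤ C := by
    filter_upwards [hae, hGb'] with s h1 h2 h0
    exact le_of_tendsto h1.abs (Eventually.of_forall fun k => h2 k h0)
  have hhm : AEMeasurable h := aemeasurable_of_tendsto_metrizable_ae' (fun k => (hGm k).aemeasurable) hae
  have hhi : IntegrableOn h (Ioc 0 T) := by
    apply Measure.integrableOn_of_bounded (M := C) (by simp) hhm.aestronglyMeasurable
    rw [ae_restrict_iff' measurableSet_Ioc]
    filter_upwards [hhb] with s h1 h2 using h1 h2.1.le
  have hne : ¬ ∀ᵐ s, s ∈ Ioc 0 T → h s = 0 := by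
    intro hz
    have hd : Tendsto (fun k => ∫ s in (0:ℝ)..T, |G k s| ^ r) atTop
        (𝓝 (∫ s in (0:ℝ)..T, (0:ℝ))) := by
      apply intervalIntegral.tendsto_integral_filter_of_dominated_convergence (fun _ => C ^ r)
      · exact Eventually.of_forall fun k =>
          (((hGm k).norm).pow_const r).aestronglyMeasurable
      · refine Eventually.of_forall fun k => ?_
        filter_upwards [hGb k] with s h1 h2
        rw [uIoc_of_le hT.le] at h2
        rw [Real.norm_eq_abs, abs_of_nonneg (by positivity)]
        have := h1 h2.1.le
        gcongr
      · exact intervalIntegrable_const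
      · filter_upwards [hae, hz] with s h1 h2 h3
        rw [uIoc_of_le hT.le] at h3
        have := (h1.abs).rpow_const (p := r) (Or.inr hr.le)
        rw [h2 h3, abs_zero, Real.zero_rpow hr.ne'] at this
        exact this
    rw [intervalIntegral.integral_zero] at hd
    have h1 := hd.eventually (gt_mem_nhds hc0)
    have h2 := hφtop.eventually hev
    obtain ⟨k, hk1, hk2⟩ := (h1.and h2).exists
    have : ∫ s in (0:ℝ)..T, |G k s| ^ r = ∫ s in (t (φ k))..(t (φ k) + T), |gh s v₀| ^ r := by
      have := intervalIntegral.integral_comp_add_left (a := 0) (b := T)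
        (fun s => |gh s v₀| ^ r) (t (φ k))
      rw [add_zero] at this
      exact this
    rw [this] at hk1
    simp only [Function.comp_apply] at hk2
    linarith
  obtain ⟨h0, hh0, a, b, ha, hab, hb, hleb⟩ := lebesgue_point hhi hne
  have hd : Tendsto (fun k => ∫ s in (0:ℝ)..T, |G k s - h s|) atTop
      (𝓝 (∫ s in (0:ℝ)..T, (0:ℝ))) := by
    apply intervalIntegral.tendsto_integral_filter_of_dominated_convergence (fun _ => C + C)
    · exact Eventually.of_forall fun k =>
        ((hGm k).aemeasurable.sub hhm).norm.aestronglyMeasurable.restrict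
    · refine Eventually.of_forall fun k => ?_
      filter_upwards [hGb k, hhb] with s h1 h3 h2
      rw [uIoc_of_le hT.le] at h2
      rw [Real.norm_eq_abs, abs_abs]
      exact (abs_sub _ _).trans (add_le_add (h1 h2.1.le) (h3 h2.1.le))
    · exact intervalIntegrable_const
    · filter_upwards [hae] with s h1 h3
      have := (h1.sub_const (h s)).abs
      simpa using this
  rw [intervalIntegral.integral_zero] at hd
  have hpos : 0 < (b - a) * |h0| := mul_pos (by linarith) (abs_pos.2 hh0)
  have h1 := hd.eventually (gt_mem_nhds (show 0 < (b - a) * |h0| / 8 by positivity))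
  have h2 := ((tendsto_one_div_add_atTop_nhds_zero_nat (𝕜 := ℝ)).comp hφ.tendsto_atTop).eventually
    (gt_mem_nhds (show 0 < (b - a) * |h0| / 8 by positivity))
  obtain ⟨k, hk1, hk2⟩ := (h1.and h2).exists
  have hLk := hL (φ k)
  have hs := hsmall (φ k) a b ha.le hab.le (by linarith)
  have hk3 : 1 / ((φ k : ℝ) + 1) < (b - a) * |h0| / 8 := hk2
  have hwi : IntervalIntegrable (w (φ k)) volume a b := (hw (φ k)).mono_set (by
    rw [uIcc_of_le hab.le, uIcc_of_le (by linarith)]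
    exact Icc_subset_Icc ha.le (by linarith))
  have hei : IntervalIntegrable (e (φ k)) volume a b := (he (φ k)).mono_set (by
    rw [uIcc_of_le hab.le, uIcc_of_le (by linarith)]
    exact Icc_subset_Icc ha.le (by linarith))
  have hhi2 : IntervalIntegrable h volume 0 T := (intervalIntegrable_iff_integrableOn_Ioc_of_le hT.le).2 hhi
  have hGi2 : IntervalIntegrable (G k) volume 0 T := by
    rw [intervalIntegrable_iff_integrableOn_Ioc_of_le hT.le]
    apply Measure.integrableOn_of_bounded (M := C) (by simp) (hGm k).aestronglyMeasurable
    rw [ae_restrict_iff' measurableSet_Ioc]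
    filter_upwards [hGb k] with s h1 h2 using h1 h2.1.le
  have hsub : uIcc a b ⊆ uIcc 0 T := by
    rw [uIcc_of_le hab.le, uIcc_of_le (by linarith)]
    exact Icc_subset_Icc ha.le (by linarith)
  have hDi2 : IntervalIntegrable (fun s => |G k s - h s|) volume 0 T := (hGi2.sub hhi2).abs
  have hDi := hDi2.mono_set hsub
  have hHi : IntervalIntegrable (fun s => |h s - h0|) volume a b :=
    ((hhi2.mono_set hsub).sub intervalIntegrable_const).abs
  have hE1 : ∫ s in a..b, e (φ k) s ≤ ∫ s in (0:ℝ)..(L (φ k)), e (φ k) s := by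
    apply intervalIntegral.integral_mono_interval ha.le hab.le (by linarith) _ (he _)
    rw [EventuallyLE, ae_restrict_iff' measurableSet_Ioc]
    filter_upwards [hu (φ k)] with s hs1 hs2
    obtain ⟨u, _, hu2⟩ := hs1 hs2
    exact (abs_nonneg _).trans hu2
  have hE2 : ∫ s in a..b, |G k s - h s| ≤ ∫ s in (0:ℝ)..T, |G k s - h s| := by
    apply intervalIntegral.integral_mono_interval ha.le hab.le hb.le _ hDi2
    exact Eventually.of_forall fun s => abs_nonneg _
  have hmain : ∫ s in a..b, (|h0| * |h0| - |h0| * (e (φ k) s + 2 * |G k s - h s| + 2 * |h s - h0|)) ≤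
      ∫ s in a..b, h0 * w (φ k) s := by
    apply intervalIntegral.integral_mono_ae_restrict hab.le
    · exact intervalIntegrable_const.sub
        (((hei.add (hDi.const_mul 2)).add (hHi.const_mul 2)).const_mul _)
    · exact hwi.const_mul _
    · rw [EventuallyLE, ae_restrict_iff' measurableSet_Icc]
      filter_upwards [hu (φ k)] with s hs1 hs2
      obtain ⟨u, ⟨hu1, hu2⟩, hu3⟩ := hs1 ⟨by linarith [hs2.1], by linarith [hs2.2]⟩
      have e1 : |w (φ k) s - u * h0| ≤ e (φ k) s + 2 * |G k s - h s| + 2 * |h s - h0| := by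
        have : w (φ k) s - u * h0 = (w (φ k) s - u * gh (t (φ k) + s) v₀) + u * (G k s - h s)
          + u * (h s - h0) := by simp only [hG]; ring
        rw [this]
        refine (abs_add_le _ _).trans (add_le_add ((abs_add_le _ _).trans (add_le_add hu3 ?_)) ?_)
        · rw [abs_mul, abs_of_nonneg (by linarith)]; gcongr
        · rw [abs_mul, abs_of_nonneg (by linarith)]; gcongr
      have e2 : -(|h0| * |w (φ k) s - u * h0|) ≤ h0 * (w (φ k) s - u * h0) := by
        rw [← abs_mul]; exact neg_abs_le _
      have e3 := mul_le_mul_of_nonneg_left e1 (abs_nonneg h0)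
      have e4 : |h0| * |h0| = h0 * h0 := abs_mul_abs_self h0
      nlinarith [mul_nonneg (sub_nonneg.2 hu1) (mul_self_nonneg h0)]
  rw [intervalIntegral.integral_sub intervalIntegrable_const
      (((hei.add (hDi.const_mul 2)).add (hHi.const_mul 2)).const_mul _),
    intervalIntegral.integral_const_mul, intervalIntegral.integral_const_mul,
    intervalIntegral.integral_add (hei.add (hDi.const_mul 2)) (hHi.const_mul 2),
    intervalIntegral.integral_add hei (hDi.const_mul 2),
    intervalIntegral.integral_const_mul, intervalIntegral.integral_const_mul,
    intervalIntegral.integral_const, smul_eq_mul] at hmain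
  have hfin : ∫ s in a..b, h0 * w (φ k) s ≤ |h0| * |∫ s in a..b, w (φ k) s| := by
    rw [intervalIntegral.integral_const_mul, ← abs_mul]; exact le_abs_self _
  have hpos0 : 0 < |h0| := abs_pos.2 hh0
  have hA : (b - a) * (|h0| * |h0|) ≤ |h0| * (|∫ s in a..b, w (φ k) s| + (∫ s in a..b, e (φ k) s)
      + 2 * (∫ s in a..b, |G k s - h s|) + 2 * ∫ s in a..b, |h s - h0|) := by linarith
  have hB : (b - a) * |h0| ≤ (|∫ s in a..b, w (φ k) s| + (∫ s in a..b, e (φ k) s)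
      + 2 * (∫ s in a..b, |G k s - h s|) + 2 * ∫ s in a..b, |h s - h0|) := by
    apply le_of_mul_le_mul_left _ hpos0
    linarith
  linarith
lemma classK_small {ω : ℝ → ℝ} (h : ClassK ω) {δ : ℝ} (hδ : 0 < δ) :
    ∃ d, 0 < d ∧ ∀ z, 0 ≤ z → z < d → ω z < δ := by
  have h1 := h.1 0 (mem_Ici.2 le_rfl)
  have h2 : Tendsto ω (𝓝[Ici 0] 0) (𝓝 0) := by
    have := h1.tendsto; rwa [h.2.2] at this
  have h3 := h2.eventually (gt_mem_nhds hδ)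
  obtain ⟨d, hd, h4⟩ := Metric.mem_nhdsWithin_iff.1 h3
  refine ⟨d, hd, fun z hz hzd => h4 ⟨?_, hz⟩⟩
  rw [Metric.mem_ball, Real.dist_eq, sub_zero, abs_of_nonneg hz]; exact hzd

lemma PE_compact {gh : ℝ → ℝ → ℝ}
    (hω : ∀ R : ℝ, ∃ ω : ℝ → ℝ, ClassK ω ∧ ∀ᵐ t : ℝ, 0 ≤ t → ∀ v v' : ℝ, |v| ≤ R → |v'| ≤ R →
      |gh t v - gh t v'| ≤ ω |v - v'|)
    (hs : ∀ v, v ≠ 0 → PEU gh {v}) {a R : ℝ} (ha : 0 < a) :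
    PEU gh {v | a ≤ |v| ∧ |v| ≤ R} := by
  have hcomp : IsCompact {v : ℝ | a ≤ |v| ∧ |v| ≤ R} := by
    apply (isCompact_Icc (a := -R) (b := R)).of_isClosed_subset
    · exact (isClosed_le continuous_const continuous_abs).inter
        (isClosed_le continuous_abs continuous_const)
    · intro v hv; exact abs_le.1 hv.2
  refine hcomp.induction_on (p := PEU gh) ?_ ?_ ?_ ?_
  · exact ⟨1, one_pos, 1, one_pos, 0, fun v hv => hv.elim⟩
  · rintro S S' hSS ⟨T0, hT0, ρ, hρ, t', h⟩
    exact ⟨T0, hT0, ρ, hρ, t', fun v hv => h v (hSS hv)⟩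
  · rintro S S' ⟨T1, hT1, ρ1, hρ1, t1, h1⟩ ⟨T2, hT2, ρ2, hρ2, t2, h2⟩
    refine ⟨max T1 T2, lt_max_of_lt_left hT1, min ρ1 ρ2, lt_min hρ1 hρ2, max t1 t2, ?_⟩
    intro v hv t ht L hL w e hw he hu
    rcases hv with hv | hv
    · obtain ⟨a, b, q1, q2, q3, q4⟩ := h1 v hv t ((le_max_left _ _).trans ht) L
        ((le_max_left _ _).trans hL) w e hw he hu
      exact ⟨a, b, q1, q2, q3, (min_le_left _ _).trans q4⟩
    · obtain ⟨a, b, q1, q2, q3, q4⟩ := h2 v hv t ((le_max_right _ _).trans ht) L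
        ((le_max_right _ _).trans hL) w e hw he hu
      exact ⟨a, b, q1, q2, q3, (min_le_right _ _).trans q4⟩
  · intro v0 hv0
    have hne : v0 ≠ 0 := by
      rintro rfl; have := hv0.1; rw [abs_zero] at this; linarith
    obtain ⟨T0, hT0, ρ, hρ, t', h⟩ := hs v0 hne
    obtain ⟨ω, hω1, hω2⟩ := hω R
    obtain ⟨d, hd, hd2⟩ := classK_small hω1 (show 0 < ρ / (4 * T0) by positivity)
    refine ⟨{v | |v| ≤ R} ∩ {v | |v - v0| < d}, ?_, T0, hT0, ρ / 2, by linarith, max t' 0, ?_⟩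
    · apply inter_mem
      · exact mem_of_superset self_mem_nhdsWithin fun v hv => hv.2
      · apply mem_nhdsWithin_of_mem_nhds
        have := Metric.ball_mem_nhds v0 hd
        filter_upwards [this] with v hv
        rwa [Metric.mem_ball, Real.dist_eq] at hv
    · rintro v ⟨hvR, hvd⟩ t ht L hL w e hw he hu
      have ht0 : 0 ≤ t := (le_max_right _ _).trans ht
      have hsub : uIcc 0 T0 ⊆ uIcc 0 L := by
        rw [uIcc_of_le hT0.le, uIcc_of_le (hT0.le.trans hL)]
        exact Icc_subset_Icc le_rfl hL
      have he0 := he.mono_set hsub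
      have hsh := (measurePreserving_add_left volume t).quasiMeasurePreserving.ae hω2
      obtain ⟨a', b, q1, q2, q3, q4⟩ := h v0 rfl t ((le_max_left _ _).trans ht) T0 le_rfl w
        (fun s => e s + 2 * (ρ / (4 * T0))) (hw.mono_set hsub)
        (he0.add intervalIntegrable_const) (by
          filter_upwards [hu, hsh] with s hs1 hs2 hs3
          obtain ⟨u, hu1, hu2⟩ := hs1 ⟨hs3.1, hs3.2.trans hL⟩
          refine ⟨u, hu1, ?_⟩
          have h1 := hs2 (by linarith [hs3.1]) v v0 hvR hv0.2
          have h2 := hd2 _ (abs_nonneg _) hvd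
          have : w s - u * gh (t + s) v0 = (w s - u * gh (t + s) v)
            + u * (gh (t + s) v - gh (t + s) v0) := by ring
          rw [this]
          refine (abs_add_le _ _).trans (add_le_add hu2 ?_)
          rw [abs_mul, abs_of_nonneg (by linarith [hu1.1])]
          have := hu1.2
          gcongr
          exact h1.trans h2.le)
      refine ⟨a', b, q1, q2, q3.trans hL, ?_⟩
      rw [intervalIntegral.integral_add he0 intervalIntegrable_const,
        intervalIntegral.integral_const, smul_eq_mul] at q4
      have hE1 : ∫ s in (0:ℝ)..T0, e s ≤ ∫ s in (0:ℝ)..L, e s := by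
        apply intervalIntegral.integral_mono_interval le_rfl hT0.le hL _ he
        rw [EventuallyLE, ae_restrict_iff' measurableSet_Ioc]
        filter_upwards [hu] with s hs1 hs2
        obtain ⟨u, _, hu2⟩ := hs1 hs2
        exact (abs_nonneg _).trans hu2
      have : (T0 - 0) * (2 * (ρ / (4 * T0))) = ρ / 2 := by field_simp; ring
      linarith
lemma window_case {G : ℝ → ℝ → ℝ → ℝ} {R C ε T0 ρ t' L : ℝ} {ω : ℝ → ℝ}
    (hR : 0 < R) (hC : 1 ≤ C) (hε : 0 < ε) (hω : ClassK ω)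
    (hGω : ∀ᵐ t : ℝ, 0 ≤ t → ∀ p q v : ℝ, p ^ 2 + q ^ 2 ≤ R ^ 2 → |v| ≤ R →
      |G t p q - G t v 0| ≤ ω (|p - v| + |q|))
    (hGC : ∀ᵐ t : ℝ, 0 ≤ t → ∀ p q : ℝ, p ^ 2 + q ^ 2 ≤ R ^ 2 → |G t p q| ≤ C)
    (hρ : 0 < ρ) (hL0 : 0 ≤ L) (hL : T0 ≤ L)
    (hPE : ∀ v ∈ {v : ℝ | ε / 2 ≤ |v| ∧ |v| ≤ R}, ∀ t, t' ≤ t → ∀ L, T0 ≤ L →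
    ∀ w e : ℝ → ℝ, IntervalIntegrable w volume 0 L → IntervalIntegrable e volume 0 L →
    (∀ᵐ s, s ∈ Ioc 0 L → ∃ u ∈ Icc (1:ℝ) 2, |w s - u * G (t + s) v 0| ≤ e s) →
    ∃ a b, 0 ≤ a ∧ a ≤ b ∧ b ≤ L ∧ ρ ≤ |∫ s in a..b, w s| + ∫ s in (0:ℝ)..L, e s) :
    ∀ᶠ κ : ℝ in 𝓝[>] 0, ∀ t, 0 ≤ t → t' ≤ t → ∀ p q P Q y2 : ℝ → ℝ,
      Prim p P 0 L → Prim q Q 0 L → IntervalIntegrable y2 volume 0 L →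
      ∫ s in (0:ℝ)..L, y2 s ≤ κ ^ 2 →
      (∀ s ∈ Icc 0 L, p s ^ 2 + q s ^ 2 ≤ R ^ 2) →
      (∀ s ∈ Icc 0 L, ε ^ 2 ≤ p s ^ 2 + q s ^ 2) →
      (∀ s ∈ Icc 0 L, ∀ s' ∈ Icc 0 L, p s ^ 2 + q s ^ 2 ≤ p s' ^ 2 + q s' ^ 2 + κ ^ 2) →
      (∀ᵐ s, s ∈ Ioc 0 L → (y2 s = q s ^ 2 ∧ |P s| ≤ 2 * C * |q s| ∧
          ∃ u ∈ Icc (1:ℝ) 2, Q s = u * G (t + s) (p s) (q s) * p s - q s) ∨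
        (y2 s = p s ^ 2 ∧ |P s| ≤ 3 * C * R ∧ |Q s| ≤ 3 * C * R)) →
      ∀ s0 ∈ Icc 0 L, q s0 ^ 2 ≤ κ ^ 2 → False := by
  set η : ℝ → ℝ := fun κ => √((6 * C * R * (L + 1) + 2) * κ) with hη
  set d : ℝ → ℝ := fun κ => (2 * C + 6 * C * R / ε) * (L + 1) * κ with hd
  set e0 : ℝ → ℝ := fun κ => (2 / ε) * (2 * R * ω (d κ + η κ) + 2 * C * d κ + η κ) with he0
  set K3 : ℝ := ((2 / ε) * (3 * C * R) + C) * (4 / ε ^ 2) with hK3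
  have hK3p : 0 ≤ K3 := by positivity
  have hdp : ∀ κ, 0 ≤ κ → 0 ≤ d κ := fun κ hκ => by simp only [hd]; positivity
  have hηp : ∀ κ, 0 ≤ η κ := fun κ => Real.sqrt_nonneg _
  have hωp : ∀ z, 0 ≤ z → 0 ≤ ω z := fun z hz => by
    have := hω.2.1.monotoneOn (mem_Ici.2 le_rfl) (mem_Ici.2 hz) hz
    rwa [hω.2.2] at this
  have lim_id : Tendsto (fun κ : ℝ => κ) (𝓝[>] 0) (𝓝 0) := tendsto_id.mono_left nhdsWithin_le_nhds
  have lim_d : Tendsto d (𝓝[>] 0) (𝓝 0) := by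
    simpa using lim_id.const_mul ((2 * C + 6 * C * R / ε) * (L + 1))
  have lim_η : Tendsto η (𝓝[>] 0) (𝓝 0) := by
    have := (lim_id.const_mul (6 * C * R * (L + 1) + 2)).sqrt
    simpa using this
  have lim_ω : Tendsto (fun κ => ω (d κ + η κ)) (𝓝[>] 0) (𝓝 0) := by
    have h1 : Tendsto ω (𝓝[Ici 0] 0) (𝓝 0) := by
      have := (hω.1 0 (mem_Ici.2 le_rfl)).tendsto; rwa [hω.2.2] at this
    apply h1.comp
    apply tendsto_nhdsWithin_iff.2 ⟨by simpa using lim_d.add lim_η, ?_⟩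
    filter_upwards [self_mem_nhdsWithin] with κ hκ
    exact add_nonneg (hdp κ (le_of_lt hκ)) (hηp κ)
  have lim_e0 : Tendsto e0 (𝓝[>] 0) (𝓝 0) := by
    have := (((lim_ω.const_mul (2 * R)).add (lim_d.const_mul (2 * C))).add lim_η).const_mul (2 / ε)
    simpa using this
  have lim_all : Tendsto (fun κ => (4 / ε) * η κ + (L * e0 κ + K3 * κ ^ 2)) (𝓝[>] 0) (𝓝 0) := by
    have := (lim_η.const_mul (4 / ε)).add ((lim_e0.const_mul L).add ((lim_id.pow 2).const_mul K3))
    simpa using this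
  have lim_sm : Tendsto (fun κ => (6 * C * R * (L + 1) + 1) * κ) (𝓝[>] 0) (𝓝 0) := by
    simpa using lim_id.const_mul (6 * C * R * (L + 1) + 1)
  filter_upwards [self_mem_nhdsWithin, lim_id.eventually (gt_mem_nhds one_pos),
    lim_all.eventually (gt_mem_nhds hρ),
    lim_sm.eventually (gt_mem_nhds (show 0 < ε ^ 2 / 2 by positivity))] with κ hκ hκ1 hall hsm
  have hκ0 : 0 < κ := hκ
  intro t ht0 ht p q P Q y2 hp hq hy hyκ hVR hVε hVd hm s0 hs0 hq0
  have hcb := core_bounds hR hC hκ0 hκ1.le hε hp hy hyκ hVR hVε hVd (by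
    filter_upwards [hm] with s hs h
    rcases hs h with ⟨h1, h2, _⟩ | ⟨h1, h2, _⟩
    · exact Or.inl ⟨h1, h2⟩
    · exact Or.inr ⟨h1, h2⟩) hs0 hq0 hsm.le
  have hqη : ∀ s ∈ Icc 0 L, |q s| ≤ η κ := fun s hs => Real.abs_le_sqrt (hcb s hs).2.1
  have hpd : ∀ s ∈ Icc 0 L, |p s - p s0| ≤ d κ := fun s hs => (hcb s hs).2.2
  have hpR : ∀ s ∈ Icc 0 L, |p s| ≤ R := fun s hs =>
    abs_le_of_sq_le_sq (by nlinarith [hVR s hs, sq_nonneg (q s)]) hR.le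
  set v := p s0 with hv
  have hv1 : ε / 2 ≤ |v| := (hcb s0 hs0).1
  have hv2 : |v| ≤ R := hpR s0 hs0
  have hvp : 0 < |v| := by linarith
  have hvn : v ≠ 0 := abs_pos.1 hvp
  have hvinv : |v|⁻¹ ≤ 2 / ε := by
    rw [show 2 / ε = (ε / 2)⁻¹ by rw [inv_div]]
    exact inv_anti₀ (by linarith) hv1
  have he0p : 0 ≤ e0 κ := by
    have h1 := hωp _ (add_nonneg (hdp κ hκ0.le) (hηp κ))
    have h2 := hdp κ hκ0.le
    have h3 := hηp κ
    simp only [he0]; positivity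
  have hsω := (measurePreserving_add_left volume t).quasiMeasurePreserving.ae hGω
  have hsC := (measurePreserving_add_left volume t).quasiMeasurePreserving.ae hGC
  obtain ⟨a, b, ha, hab, hb, hfin⟩ := hPE v ⟨hv1, hv2⟩ t ht L hL (fun s => Q s * v⁻¹)
    (fun s => e0 κ + K3 * y2 s) (hq.1.mul_const _) (intervalIntegrable_const.add (hy.const_mul _)) (by
      filter_upwards [hm, hsω, hsC] with s hs1 hs2 hs3 hs4
      have hs' : s ∈ Icc 0 L := ⟨hs4.1.le, hs4.2⟩
      have hts : 0 ≤ t + s := by linarith [hs4.1]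
      have hGv : |G (t + s) v 0| ≤ C := hs3 hts v 0 (by
        rw [← sq_abs v]; nlinarith [abs_nonneg v])
      rcases hs1 hs4 with ⟨h1, h2, u, hu, hQ⟩ | ⟨h1, h2, hQ⟩
      · refine ⟨u, hu, ?_⟩
        have hw1 : |G (t + s) (p s) (q s) - G (t + s) v 0| ≤ ω (d κ + η κ) := by
          refine (hs2 hts (p s) (q s) v (hVR s hs') hv2).trans ?_
          apply hω.2.1.monotoneOn
          · exact mem_Ici.2 (by positivity)
          · exact mem_Ici.2 (add_nonneg (hdp κ hκ0.le) (hηp κ))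
          · exact add_le_add (hpd s hs') (hqη s hs')
        have heq : Q s * v⁻¹ - u * G (t + s) v 0 =
            (u * (p s * (G (t + s) (p s) (q s) - G (t + s) v 0)) + u * (G (t + s) v 0 * (p s - v))
              + -(q s)) * v⁻¹ := by
          rw [hQ]; field_simp; ring
        have hy0 : 0 ≤ y2 s := by rw [h1]; positivity
        have hu0 : |u| ≤ 2 := by rw [abs_of_nonneg (by linarith [hu.1])]; exact hu.2
        rw [heq, abs_mul, abs_inv]
        have hA : |u * (p s * (G (t + s) (p s) (q s) - G (t + s) v 0)) + u * (G (t + s) v 0 * (p s - v))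
              + -(q s)| ≤ 2 * (R * ω (d κ + η κ)) + 2 * (C * d κ) + η κ := by
          refine (abs_add_le _ _).trans (add_le_add ((abs_add_le _ _).trans (add_le_add ?_ ?_)) ?_)
          · rw [abs_mul, abs_mul]
            have := hpR s hs'
            gcongr
          · rw [abs_mul, abs_mul]
            have := hpd s hs'
            gcongr
          · rw [abs_neg]; exact hqη s hs'
        calc _ ≤ (2 * (R * ω (d κ + η κ)) + 2 * (C * d κ) + η κ) * (2 / ε) :=
              mul_le_mul hA hvinv (by positivity) ((abs_nonneg _).trans hA)
          _ = e0 κ + 0 := by simp only [he0]; ring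
          _ ≤ e0 κ + K3 * y2 s := by gcongr; positivity
      · refine ⟨1, ⟨le_rfl, one_le_two⟩, ?_⟩
        have hpl := (hcb s hs').1
        have hp2 : ε ^ 2 / 4 ≤ y2 s := by
          rw [h1, ← sq_abs (p s)]; nlinarith
        have hA : |Q s * v⁻¹ - 1 * G (t + s) v 0| ≤ (2 / ε) * (3 * C * R) + C := by
          refine (abs_sub _ _).trans ?_
          rw [one_mul, abs_mul, abs_inv, mul_comm]
          gcongr
        calc _ ≤ ((2 / ε) * (3 * C * R) + C) * 1 := by rw [mul_one]; exact hA
          _ = K3 * (ε ^ 2 / 4) := by simp only [hK3]; field_simp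
          _ ≤ K3 * y2 s := by gcongr
          _ ≤ _ := by linarith)
  rw [intervalIntegral.integral_mul_const, ← (hq.sub ha hab hb).eq hab,
    intervalIntegral.integral_add intervalIntegrable_const (hy.const_mul _),
    intervalIntegral.integral_const, intervalIntegral.integral_const_mul, smul_eq_mul, abs_mul,
    abs_inv] at hfin
  have h1 : |q b - q a| * |v|⁻¹ ≤ (η κ + η κ) * (2 / ε) := by
    apply mul_le_mul _ hvinv (by positivity) (by have := hηp κ; positivity)
    exact (abs_sub _ _).trans (add_le_add (hqη b ⟨ha.trans hab, hb⟩) (hqη a ⟨ha, hab.trans hb⟩))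
  have h2 : K3 * ∫ s in (0:ℝ)..L, y2 s ≤ K3 * κ ^ 2 := by gcongr
  have h3 : (η κ + η κ) * (2 / ε) = 4 / ε * η κ := by ring
  linarith
lemma sol_prim {f : ℝ → E 2 → Fin 3 → E 2} (T : Sol (univ : Set (E 2)) f) {t L : ℝ}
    (ht : T.t0 ≤ t) (hL : 0 ≤ L) (htL : ((t + L : ℝ) : EReal) < T.tf) (i : Fin 2) :
    Prim (fun s => T.x (t + s) i) (fun s => f (t + s) (T.x (t + s)) (T.σ (t + s)) i) 0 L := by
  have hlt : ∀ s, s ≤ L → ((t + s : ℝ) : EReal) < T.tf := fun s hs =>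
    lt_of_le_of_lt (by exact_mod_cast (by linarith)) htL
  have hItg : ∀ s, 0 ≤ s → s ≤ L →
      IntervalIntegrable (fun τ => f τ (T.x τ) (T.σ τ)) volume t (t + s) := fun s h0 hs =>
    T.intg t (t + s) ht (by linarith) (hlt s hs)
  have hcoord : ∀ {a b : ℝ}, IntervalIntegrable (fun τ => f τ (T.x τ) (T.σ τ)) volume a b →
      IntervalIntegrable (fun τ => f τ (T.x τ) (T.σ τ) i) volume a b := by
    intro a b h
    exact ⟨(EuclideanSpace.proj (𝕜 := ℝ) i).integrable_comp h.1,
      (EuclideanSpace.proj (𝕜 := ℝ) i).integrable_comp h.2⟩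
  refine ⟨?_, fun s hs => ?_⟩
  · have h := (hcoord (hItg L hL le_rfl)).comp_add_left t
    simpa using h
  · have h1 := T.sol t (t + s) ht (by linarith [hs.1]) (hlt s hs.2)
    have h2 := (EuclideanSpace.proj (𝕜 := ℝ) i).intervalIntegral_comp_comm
      (hItg s hs.1 hs.2)
    have h3 := intervalIntegral.integral_comp_add_left (a := 0) (b := s)
      (fun τ => f τ (T.x τ) (T.σ τ) i) t
    simp only [add_zero] at h3 ⊢
    rw [h3]
    have h4 : T.x (t + s) i = T.x t i + (∫ τ in t..(t + s), f τ (T.x τ) (T.σ τ)) i := by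
      conv_lhs => rw [h1]
      rfl
    rw [h4]
    congr 1
    exact h2.symm

lemma norm_sq2 (ξ : E 2) : ‖ξ‖ ^ 2 = ξ 0 ^ 2 + ξ 1 ^ 2 := by
  rw [EuclideanSpace.real_norm_sq_eq]; simp [Fin.sum_univ_two]

/-- Dissipation rate. -/
def yy (f : ℝ → E 2 → Fin 3 → E 2) (T : Sol (univ : Set (E 2)) f) (τ : ℝ) : ℝ :=
  -(T.x τ 0 * f τ (T.x τ) (T.σ τ) 0 + T.x τ 1 * f τ (T.x τ) (T.σ τ) 1)

lemma yy_int {f : ℝ → E 2 → Fin 3 → E 2} (T : Sol (univ : Set (E 2)) f) {t L : ℝ}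
    (ht : T.t0 ≤ t) (hL : 0 ≤ L) (htL : ((t + L : ℝ) : EReal) < T.tf) :
    IntervalIntegrable (fun s => yy f T (t + s)) volume 0 L ∧
    ‖T.x t‖ ^ 2 - ‖T.x (t + L)‖ ^ 2 = 2 * ∫ s in (0:ℝ)..L, yy f T (t + s) := by
  have h0 := sol_prim T ht hL htL 0
  have h1 := sol_prim T ht hL htL 1
  have i0 := h0.mulInt hL
  have i1 := h1.mulInt hL
  have e0 := h0.sq_eq hL
  have e1 := h1.sq_eq hL
  have hy : (fun s => yy f T (t + s)) = fun s => (-(1/2 : ℝ)) *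
      (2 * (T.x (t + s) 0 * f (t + s) (T.x (t + s)) (T.σ (t + s)) 0) +
      2 * (T.x (t + s) 1 * f (t + s) (T.x (t + s)) (T.σ (t + s)) 1)) := by
    funext s; unfold yy; ring
  rw [hy]
  refine ⟨(i0.add i1).const_mul _, ?_⟩
  rw [intervalIntegral.integral_const_mul, intervalIntegral.integral_add i0 i1, ← e0, ← e1,
    norm_sq2, norm_sq2]
  simp only [add_zero]; ring

/-- Structure of the three modes. -/
def Modes (g₁ g₂ : ℝ → E 2 → ℝ) (f : ℝ → E 2 → Fin 3 → E 2) : Prop :=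
  ∀ (t : ℝ) (ξ : E 2), (f t ξ 0 0 = -(g₁ t ξ * ξ 1) ∧ f t ξ 0 1 = g₁ t ξ * ξ 0 - ξ 1) ∧
    (f t ξ 1 0 = g₂ t ξ * ξ 1 - ξ 0 ∧ f t ξ 1 1 = -(g₂ t ξ * ξ 0)) ∧
    (f t ξ 2 0 = 2 * g₂ t ξ * ξ 1 - ξ 0 ∧ f t ξ 2 1 = -(2 * g₂ t ξ * ξ 0))

lemma yy_cases {g₁ g₂ : ℝ → E 2 → ℝ} {f : ℝ → E 2 → Fin 3 → E 2} (hf : Modes g₁ g₂ f)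
    (T : Sol (univ : Set (E 2)) f) (τ : ℝ) :
    (T.σ τ = 0 ∧ yy f T τ = T.x τ 1 ^ 2) ∨
    ((T.σ τ = 1 ∨ T.σ τ = 2) ∧ yy f T τ = T.x τ 0 ^ 2) := by
  obtain ⟨⟨a0, a1⟩, ⟨b0, b1⟩, c0, c1⟩ := hf τ (T.x τ)
  have : ∀ i : Fin 3, i = 0 ∨ i = 1 ∨ i = 2 := by decide
  unfold yy
  rcases this (T.σ τ) with h | h | h <;> rw [h]
  · left; rw [a0, a1]; exact ⟨rfl, by ring⟩
  · right; rw [b0, b1]; exact ⟨Or.inl rfl, by ring⟩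
  · right; rw [c0, c1]; exact ⟨Or.inr rfl, by ring⟩

lemma yy_nonneg {g₁ g₂ : ℝ → E 2 → ℝ} {f : ℝ → E 2 → Fin 3 → E 2} (hf : Modes g₁ g₂ f)
    (T : Sol (univ : Set (E 2)) f) (τ : ℝ) : 0 ≤ yy f T τ := by
  rcases yy_cases hf T τ with ⟨_, h⟩ | ⟨_, h⟩ <;> rw [h] <;> positivity

lemma sol_antitone {g₁ g₂ : ℝ → E 2 → ℝ} {f : ℝ → E 2 → Fin 3 → E 2} (hf : Modes g₁ g₂ f)
    (T : Sol (univ : Set (E 2)) f) {s t : ℝ} (hs : T.t0 ≤ s) (hst : s ≤ t)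
    (ht : (t : EReal) < T.tf) : ‖T.x t‖ ^ 2 ≤ ‖T.x s‖ ^ 2 := by
  have h := (yy_int T (L := t - s) hs (by linarith) (by rwa [add_sub_cancel])).2
  have h2 : 0 ≤ ∫ τ in (0:ℝ)..(t - s), yy f T (s + τ) :=
    intervalIntegral.integral_nonneg (by linarith) fun u _ => yy_nonneg hf T _
  rw [add_sub_cancel] at h
  linarith
lemma ae_of_J {J : Set ℝ} (hJ : volume (Ici (0:ℝ) \ J) = 0) : ∀ᵐ t : ℝ, 0 ≤ t → t ∈ J := by
  rw [ae_iff]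
  convert hJ using 2
  ext t; simp

lemma g_bdd {g : ℝ → E 2 → ℝ} (h : UnifBounded (univ : Set (E 2)) g) (R : ℝ) :
    ∃ C, 1 ≤ C ∧ ∀ᵐ t : ℝ, 0 ≤ t → ∀ ξ : E 2, ‖ξ‖ ≤ R → |g t ξ| ≤ C := by
  obtain ⟨J, _, hJ, h⟩ := h
  obtain ⟨C, hC⟩ := h (Metric.closedBall 0 R) (isCompact_closedBall 0 R) (subset_univ _)
  refine ⟨max C 1, le_max_right _ _, ?_⟩
  filter_upwards [ae_of_J hJ] with t ht h0 ξ hξ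
  exact (hC t (ht h0) ξ (by simpa using hξ)).trans (le_max_left _ _)

lemma g_cont {g : ℝ → E 2 → ℝ} (h : ContXiUnifT (univ : Set (E 2)) g) (R : ℝ) :
    ∃ ω, ClassK ω ∧ ∀ᵐ t : ℝ, 0 ≤ t → ∀ ξ ζ : E 2, ‖ξ‖ ≤ R → ‖ζ‖ ≤ R →
      |g t ξ - g t ζ| ≤ ω ‖ξ - ζ‖ := by
  obtain ⟨J, _, hJ, h⟩ := h
  obtain ⟨ω, hω, hC⟩ := h (Metric.closedBall 0 R) (isCompact_closedBall 0 R) (subset_univ _)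
  refine ⟨ω, hω, ?_⟩
  filter_upwards [ae_of_J hJ] with t ht h0 ξ ζ hξ hζ
  exact hC t (ht h0) ξ (by simpa using hξ) ζ (by simpa using hζ)

lemma half_case {g : ℝ → E 2 → ℝ} {e : ℝ → ℝ → E 2}
    (hb : UnifBounded (univ : Set (E 2)) g) (hc : ContXiUnifT (univ : Set (E 2)) g)
    (hm : ∀ ξ, Measurable fun t => g t ξ)
    (hpre : Precompact (univ : Set ℝ) (fun t v => g t (e v 0)))
    (hPE : ∀ v₀ : ℝ, v₀ ≠ 0 → ∃ T : ℝ, 0 < T ∧ ∃ r : ℝ, 0 < r ∧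
      0 < atTop.liminf fun t : ℝ => ∫ s in t..(t + T), |g s (e v₀ 0)| ^ r)
    (hen : ∀ p q, ‖e p q‖ ^ 2 = p ^ 2 + q ^ 2)
    (hes : ∀ p q v w, e p q - e v w = e (p - v) (q - w))
    {R ε : ℝ} (hR : 0 < R) (hε : 0 < ε) :
    ∃ T0 t' : ℝ, ∀ C, 1 ≤ C →
      (∀ᵐ t : ℝ, 0 ≤ t → ∀ ξ : E 2, ‖ξ‖ ≤ R → |g t ξ| ≤ C) → ∀ L, 0 ≤ L → T0 ≤ L →
    ∀ᶠ κ : ℝ in 𝓝[>] 0, ∀ t, 0 ≤ t → t' ≤ t → ∀ p q P Q y2 : ℝ → ℝ,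
      Prim p P 0 L → Prim q Q 0 L → IntervalIntegrable y2 volume 0 L →
      ∫ s in (0:ℝ)..L, y2 s ≤ κ ^ 2 →
      (∀ s ∈ Icc 0 L, p s ^ 2 + q s ^ 2 ≤ R ^ 2) →
      (∀ s ∈ Icc 0 L, ε ^ 2 ≤ p s ^ 2 + q s ^ 2) →
      (∀ s ∈ Icc 0 L, ∀ s' ∈ Icc 0 L, p s ^ 2 + q s ^ 2 ≤ p s' ^ 2 + q s' ^ 2 + κ ^ 2) →
      (∀ᵐ s, s ∈ Ioc 0 L → (y2 s = q s ^ 2 ∧ |P s| ≤ 2 * C * |q s| ∧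
          ∃ u ∈ Icc (1:ℝ) 2, Q s = u * g (t + s) (e (p s) (q s)) * p s - q s) ∨
        (y2 s = p s ^ 2 ∧ |P s| ≤ 3 * C * R ∧ |Q s| ≤ 3 * C * R)) →
      ∀ s0 ∈ Icc 0 L, q s0 ^ 2 ≤ κ ^ 2 → False := by
  have hev : ∀ v, ‖e v 0‖ = |v| := fun v => by
    have := hen v 0
    rw [← abs_of_nonneg (norm_nonneg (e v 0)), ← sq_eq_sq_iff_abs_eq_abs, this]; ring
  have hle : ∀ p q, p ^ 2 + q ^ 2 ≤ R ^ 2 → ‖e p q‖ ≤ R := fun p q h => by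
    rw [← hen] at h; exact (sq_le_sq₀ (norm_nonneg _) hR.le).1 h
  have hl1 : ∀ p q, ‖e p q‖ ≤ |p| + |q| := fun p q => by
    rw [← sq_le_sq₀ (norm_nonneg _) (by positivity), hen, ← sq_abs p, ← sq_abs q]
    nlinarith [mul_nonneg (abs_nonneg p) (abs_nonneg q)]
  have hs : ∀ v : ℝ, v ≠ 0 → PEU (fun t v => g t (e v 0)) {v} := by
    intro v hv
    obtain ⟨C, _, hC⟩ := g_bdd hb |v|
    refine PE_single (C := C) (hm _) ?_ hpre (hPE v hv)
    filter_upwards [hC] with t ht h0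
    exact ht h0 _ (hev v).le
  have hω : ∀ R : ℝ, ∃ ω, ClassK ω ∧ ∀ᵐ t : ℝ, 0 ≤ t → ∀ v v' : ℝ, |v| ≤ R → |v'| ≤ R →
      |g t (e v 0) - g t (e v' 0)| ≤ ω |v - v'| := by
    intro R
    obtain ⟨ω, hω, h⟩ := g_cont hc R
    refine ⟨ω, hω, ?_⟩
    filter_upwards [h] with t ht h0 v v' hv hv'
    have := ht h0 (e v 0) (e v' 0) ((hev v).trans_le hv) ((hev v').trans_le hv')
    rwa [hes, sub_zero, hev] at this
  obtain ⟨T0, hT0, ρ, hρ, t', hPEU⟩ := PE_compact (gh := fun t v => g t (e v 0)) (R := R) hω hs (half_pos hε)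
  obtain ⟨ω, hωK, hω'⟩ := g_cont hc R
  refine ⟨T0, t', fun C hC hgC L hL0 hL => ?_⟩
  refine window_case (G := fun t p q => g t (e p q)) hR hC hε hωK ?_ ?_ hρ hL0 hL hPEU
  · filter_upwards [hω'] with t ht h0 p q v hpq hv
    refine (ht h0 _ _ (hle p q hpq) ((hev v).trans_le hv)).trans ?_
    refine hωK.2.1.monotoneOn (mem_Ici.2 (norm_nonneg _)) (mem_Ici.2 (by positivity)) ?_
    rw [hes, sub_zero]; exact hl1 _ _
  · filter_upwards [hgC] with t ht h0 p q hpq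
    exact ht h0 _ (hle p q hpq)
lemma mode_bounds {g a b C R : ℝ} (hR : 0 < R) (hC : 1 ≤ C) (hg : |g| ≤ C) (ha : |a| ≤ R) (hb : |b| ≤ R)
    {u : ℝ} (hu : |u| ≤ 2) : |u * g * a| ≤ 2 * C * |a| ∧ |u * g * a| ≤ 3 * C * R ∧
      |u * g * a - b| ≤ 3 * C * R := by
  have h1 : |u * g * a| ≤ 2 * C * |a| := by
    rw [abs_mul, abs_mul]
    have : |u| * |g| ≤ 2 * C := mul_le_mul hu hg (abs_nonneg _) (by norm_num)
    exact mul_le_mul_of_nonneg_right this (abs_nonneg _)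
  have h2 : 2 * C * |a| ≤ 2 * C * R := mul_le_mul_of_nonneg_left ha (by linarith)
  have h3 : R ≤ C * R := by nlinarith
  refine ⟨h1, by linarith, ?_⟩
  have := abs_sub (u * g * a) b
  linarith

lemma window {g₁ g₂ : ℝ → E 2 → ℝ} {f : ℝ → E 2 → Fin 3 → E 2} (hf : Modes g₁ g₂ f)
    {e₁ e₂ : ℝ → ℝ → E 2}
    (hex₁ : ∀ ξ : E 2, e₁ (ξ 0) (ξ 1) = ξ) (hex₂ : ∀ ξ : E 2, e₂ (ξ 1) (ξ 0) = ξ)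
    (hb₁ : UnifBounded (univ : Set (E 2)) g₁) (hc₁ : ContXiUnifT (univ : Set (E 2)) g₁)
    (hm₁ : ∀ ξ, Measurable fun t => g₁ t ξ)
    (hpre₁ : Precompact (univ : Set ℝ) (fun t v => g₁ t (e₁ v 0)))
    (hPE₁ : ∀ v₀ : ℝ, v₀ ≠ 0 → ∃ T : ℝ, 0 < T ∧ ∃ r : ℝ, 0 < r ∧
      0 < atTop.liminf fun t : ℝ => ∫ s in t..(t + T), |g₁ s (e₁ v₀ 0)| ^ r)
    (hen₁ : ∀ p q, ‖e₁ p q‖ ^ 2 = p ^ 2 + q ^ 2)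
    (hes₁ : ∀ p q v w, e₁ p q - e₁ v w = e₁ (p - v) (q - w))
    (hb₂ : UnifBounded (univ : Set (E 2)) g₂) (hc₂ : ContXiUnifT (univ : Set (E 2)) g₂)
    (hm₂ : ∀ ξ, Measurable fun t => g₂ t ξ)
    (hpre₂ : Precompact (univ : Set ℝ) (fun t v => g₂ t (e₂ v 0)))
    (hPE₂ : ∀ v₀ : ℝ, v₀ ≠ 0 → ∃ T : ℝ, 0 < T ∧ ∃ r : ℝ, 0 < r ∧
      0 < atTop.liminf fun t : ℝ => ∫ s in t..(t + T), |g₂ s (e₂ v₀ 0)| ^ r)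
    (hen₂ : ∀ p q, ‖e₂ p q‖ ^ 2 = p ^ 2 + q ^ 2)
    (hes₂ : ∀ p q v w, e₂ p q - e₂ v w = e₂ (p - v) (q - w))
    {R ε : ℝ} (hR : 0 < R) (hε : 0 < ε) :
    ∃ L δ t' : ℝ, 0 < L ∧ 0 < δ ∧ 0 ≤ t' ∧ ∀ T : Sol (univ : Set (E 2)) f, ∀ t, t' ≤ t → T.t0 ≤ t →
      ((t + L : ℝ) : EReal) < T.tf → ‖T.x t‖ ≤ R →
      ‖T.x (t + L)‖ < ε ∨ ‖T.x (t + L)‖ ^ 2 ≤ ‖T.x t‖ ^ 2 - δ := by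
  obtain ⟨T1, t1, H1⟩ := half_case hb₁ hc₁ hm₁ hpre₁ hPE₁ hen₁ hes₁ hR hε
  obtain ⟨T2, t2, H2⟩ := half_case hb₂ hc₂ hm₂ hpre₂ hPE₂ hen₂ hes₂ hR hε
  obtain ⟨C1, hC1, hgC1⟩ := g_bdd hb₁ R
  obtain ⟨C2, hC2, hgC2⟩ := g_bdd hb₂ R
  set C := max C1 C2
  have hC : 1 ≤ C := hC1.trans (le_max_left _ _)
  set L := max 1 (max T1 T2)
  have hL1 : 1 ≤ L := le_max_left _ _
  have hL0 : 0 ≤ L := zero_le_one.trans hL1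
  have hT1 : T1 ≤ L := (le_max_left _ _).trans (le_max_right _ _)
  have hT2 : T2 ≤ L := (le_max_right _ _).trans (le_max_right _ _)
  have hg1 : ∀ᵐ t : ℝ, 0 ≤ t → ∀ ξ : E 2, ‖ξ‖ ≤ R → |g₁ t ξ| ≤ C := by
    filter_upwards [hgC1] with t h h0 ξ hξ using (h h0 ξ hξ).trans (le_max_left _ _)
  have hg2 : ∀ᵐ t : ℝ, 0 ≤ t → ∀ ξ : E 2, ‖ξ‖ ≤ R → |g₂ t ξ| ≤ C := by
    filter_upwards [hgC2] with t h h0 ξ hξ using (h h0 ξ hξ).trans (le_max_right _ _)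
  obtain ⟨κ, K1, K2, hκ⟩ := ((H1 C hC hg1 L hL0 hT1).and
    ((H2 C hC hg2 L hL0 hT2).and self_mem_nhdsWithin)).exists
  have hκ0 : 0 < κ := hκ
  refine ⟨L, κ ^ 2, max 0 (max t1 t2), by linarith, by positivity, le_max_left _ _, ?_⟩
  intro T t ht ht0 htL hxR
  by_contra! hcon
  obtain ⟨hxε, hxd⟩ := hcon
  have ht00 : 0 ≤ t := (le_max_left _ _).trans ht
  have ht1 : t1 ≤ t := ((le_max_left _ _).trans (le_max_right _ _)).trans ht
  have ht2 : t2 ≤ t := ((le_max_right _ _).trans (le_max_right _ _)).trans ht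
  have hlt : ∀ s, s ≤ L → ((t + s : ℝ) : EReal) < T.tf := fun s hs =>
    lt_of_le_of_lt (by exact_mod_cast (by linarith)) htL
  obtain ⟨hyi, hyV⟩ := yy_int T ht0 hL0 htL
  have hup : ∀ s ∈ Icc 0 L, ‖T.x (t + s)‖ ^ 2 ≤ ‖T.x t‖ ^ 2 := fun s hs =>
    sol_antitone hf T ht0 (by linarith [hs.1]) (hlt s hs.2)
  have hdn : ∀ s ∈ Icc 0 L, ‖T.x (t + L)‖ ^ 2 ≤ ‖T.x (t + s)‖ ^ 2 := fun s hs =>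
    sol_antitone hf T (by linarith [hs.1]) (by linarith [hs.2]) htL
  have hR2 : ‖T.x t‖ ^ 2 ≤ R ^ 2 := pow_le_pow_left₀ (norm_nonneg _) hxR 2
  have hε2 : ε ^ 2 ≤ ‖T.x (t + L)‖ ^ 2 := pow_le_pow_left₀ hε.le hxε 2
  have hyκ : ∫ s in (0:ℝ)..L, yy f T (t + s) ≤ κ ^ 2 / 2 := by linarith
  have hyκ' : ∫ s in (0:ℝ)..L, yy f T (t + s) ≤ κ ^ 2 := by nlinarith
  obtain ⟨s0, hs0, hys0⟩ : ∃ s0 ∈ Icc 0 L, yy f T (t + s0) ≤ κ ^ 2 := by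
    by_contra! hall
    have := intervalIntegral.integral_mono_on hL0 intervalIntegrable_const hyi
      (fun s hs => (hall s hs).le)
    rw [intervalIntegral.integral_const, smul_eq_mul, sub_zero] at this
    nlinarith [sq_pos_of_pos hκ0]
  have P0 := sol_prim T ht0 hL0 htL 0
  have P1 := sol_prim T ht0 hL0 htL 1
  have hsh : ∀ {p : ℝ → Prop}, (∀ᵐ τ : ℝ, p τ) → ∀ᵐ s : ℝ, p (t + s) := fun h =>
    (measurePreserving_add_left volume t).quasiMeasurePreserving.ae h
  have three : ∀ i : Fin 3, i = 0 ∨ i = 1 ∨ i = 2 := by decide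
  have hbd : ∀ s ∈ Icc 0 L, ‖T.x (t + s)‖ ≤ R ∧ |T.x (t + s) 0| ≤ R ∧ |T.x (t + s) 1| ≤ R := by
    intro s hs
    have h1 := (hup s hs).trans hR2
    have h2 := norm_sq2 (T.x (t + s))
    refine ⟨(sq_le_sq₀ (norm_nonneg _) hR.le).1 h1, abs_le_of_sq_le_sq ?_ hR.le,
      abs_le_of_sq_le_sq ?_ hR.le⟩ <;> nlinarith [sq_nonneg (T.x (t + s) 0), sq_nonneg (T.x (t + s) 1)]
  rcases yy_cases hf T (t + s0) with ⟨_, hc⟩ | ⟨_, hc⟩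
  · refine K1 t ht00 ht1 _ _ _ _ (fun s => yy f T (t + s)) P0 P1 hyi hyκ' ?_ ?_ ?_ ?_ s0 hs0 (by rw [← hc]; exact hys0)
    · intro s hs; rw [← norm_sq2]; exact (hup s hs).trans hR2
    · intro s hs; rw [← norm_sq2]; exact hε2.trans (hdn s hs)
    · intro s hs s' hs'
      rw [← norm_sq2, ← norm_sq2]; have := hup s hs; have := hdn s' hs'; linarith
    · filter_upwards [hsh hg1, hsh hg2] with s h1 h2 hs
      have hs' : s ∈ Icc 0 L := Ioc_subset_Icc_self hs
      obtain ⟨bn, b0, b1⟩ := hbd s hs'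
      have h1 := h1 (by linarith [hs.1]) _ bn
      have h2 := h2 (by linarith [hs.1]) _ bn
      obtain ⟨⟨a0, a1⟩, ⟨c0, c1⟩, d0, d1⟩ := hf (t + s) (T.x (t + s))
      rcases yy_cases hf T (t + s) with ⟨hσ, hy⟩ | ⟨hσ, hy⟩
      · left
        simp only [hσ, a0, a1]
        refine ⟨hy, ?_, 1, ⟨le_rfl, one_le_two⟩, ?_⟩
        · have := (mode_bounds hR hC h1 b1 b0 (u := 1) (by norm_num)).1
          rw [one_mul] at this; rwa [abs_neg]
        · rw [hex₁]; ring
      · right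
        refine ⟨hy, ?_⟩
        rcases hσ with hσ | hσ
        · have q1 := (mode_bounds hR hC h2 b1 b0 (u := 1) (by norm_num)).2.2
          have q2 := (mode_bounds hR hC h2 b0 b1 (u := 1) (by norm_num)).2.1
          simp only [hσ, c0, c1, abs_neg]
          rw [one_mul] at q1 q2
          exact ⟨q1, q2⟩
        · have q1 := (mode_bounds hR hC h2 b1 b0 (u := 2) (by norm_num)).2.2
          have q2 := (mode_bounds hR hC h2 b0 b1 (u := 2) (by norm_num)).2.1
          simp only [hσ, d0, d1, abs_neg]
          exact ⟨q1, q2⟩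
  · refine K2 t ht00 ht2 _ _ _ _ (fun s => yy f T (t + s)) P1 P0 hyi hyκ' ?_ ?_ ?_ ?_ s0 hs0 (by rw [← hc]; exact hys0)
    · intro s hs; rw [add_comm, ← norm_sq2]; exact (hup s hs).trans hR2
    · intro s hs; rw [add_comm, ← norm_sq2]; exact hε2.trans (hdn s hs)
    · intro s hs s' hs'
      rw [add_comm, ← norm_sq2, add_comm (T.x (t + s') 1 ^ 2), ← norm_sq2]
      have := hup s hs; have := hdn s' hs'; linarith
    · filter_upwards [hsh hg1, hsh hg2] with s h1 h2 hs
      have hs' : s ∈ Icc 0 L := Ioc_subset_Icc_self hs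
      obtain ⟨bn, b0, b1⟩ := hbd s hs'
      have h1 := h1 (by linarith [hs.1]) _ bn
      have h2 := h2 (by linarith [hs.1]) _ bn
      obtain ⟨⟨a0, a1⟩, ⟨c0, c1⟩, d0, d1⟩ := hf (t + s) (T.x (t + s))
      rcases yy_cases hf T (t + s) with ⟨hσ, hy⟩ | ⟨hσ, hy⟩
      · right
        simp only [hσ, a0, a1, abs_neg]
        have q1 := (mode_bounds hR hC h1 b1 b0 (u := 1) (by norm_num)).2.1
        have q2 := (mode_bounds hR hC h1 b0 b1 (u := 1) (by norm_num)).2.2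
        rw [one_mul] at q1 q2
        exact ⟨hy, q2, q1⟩
      · left
        refine ⟨hy, ?_⟩
        rcases hσ with hσ | hσ
        · have q1 := (mode_bounds hR hC h2 b0 b1 (u := 1) (by norm_num)).1
          simp only [hσ, c0, c1, abs_neg]
          rw [one_mul] at q1
          exact ⟨q1, 1, ⟨le_rfl, one_le_two⟩, by rw [hex₂]; ring⟩
        · have q1 := (mode_bounds hR hC h2 b0 b1 (u := 2) (by norm_num)).1
          simp only [hσ, d0, d1, abs_neg]
          exact ⟨q1, 2, ⟨one_le_two, le_rfl⟩, by rw [hex₂]⟩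
lemma attract {g₁ g₂ : ℝ → E 2 → ℝ} {f : ℝ → E 2 → Fin 3 → E 2} (hf : Modes g₁ g₂ f)
    {R ε : ℝ} (hε : 0 < ε)
    (W : ∃ L δ t' : ℝ, 0 < L ∧ 0 < δ ∧ 0 ≤ t' ∧ ∀ T : Sol (univ : Set (E 2)) f, ∀ t, t' ≤ t →
      T.t0 ≤ t → ((t + L : ℝ) : EReal) < T.tf → ‖T.x t‖ ≤ R →
      ‖T.x (t + L)‖ < ε ∨ ‖T.x (t + L)‖ ^ 2 ≤ ‖T.x t‖ ^ 2 - δ) :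
    ∃ Tb : ℝ, ∀ T : Sol (univ : Set (E 2)) f, ∀ s, T.InDom s → ‖T.x s‖ ≤ R →
      ∀ t, s + Tb ≤ t → (t : EReal) < T.tf → ‖T.x t‖ ≤ ε := by
  obtain ⟨L, δ, t', hL, hδ, ht', hW⟩ := W
  obtain ⟨n, hn⟩ := exists_nat_gt (R ^ 2 / δ)
  have hn' : R ^ 2 < n * δ := by rwa [div_lt_iff₀ hδ] at hn
  refine ⟨t' + n * L, fun T s hs hR t ht htf => ?_⟩
  have hR0 : 0 ≤ R := (norm_nonneg _).trans hR
  have hs0 : 0 ≤ s := T.t0_nonneg.trans hs.1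
  have anti : ∀ a b, s ≤ a → a ≤ b → (b : EReal) < T.tf → ‖T.x b‖ ≤ ‖T.x a‖ := fun a b h1 h2 h3 =>
    (sq_le_sq₀ (norm_nonneg _) (norm_nonneg _)).1 (sol_antitone hf T (hs.1.trans h1) h2 h3)
  have key : ∀ k : ℕ, ((s + t' + k * L : ℝ) : EReal) < T.tf →
      ‖T.x (s + t' + k * L)‖ ≤ ε ∨ ‖T.x (s + t' + k * L)‖ ^ 2 ≤ R ^ 2 - k * δ := by
    intro k
    induction k with
    | zero =>
      intro h
      right
      simp only [Nat.cast_zero, zero_mul, add_zero, sub_zero] at h ⊢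
      exact pow_le_pow_left₀ (norm_nonneg _) ((anti s _ le_rfl (by linarith) h).trans hR) 2
    | succ k ih =>
      intro h
      have hk : (0:ℝ) ≤ k * L := by positivity
      have e : s + t' + ((k + 1 : ℕ) : ℝ) * L = s + t' + k * L + L := by push_cast; ring
      rw [e] at h ⊢
      have h1 : ((s + t' + k * L : ℝ) : EReal) < T.tf :=
        lt_of_le_of_lt (by exact_mod_cast (by linarith)) h
      rcases ih h1 with h2 | h2
      · left; exact (anti _ _ (by linarith) (by linarith) h).trans h2
      · rcases hW T (s + t' + k * L) (by linarith) (by linarith [hs.1]) h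
          ((anti s _ le_rfl (by linarith) h1).trans hR) with h3 | h3
        · left; exact h3.le
        · right; push_cast; linarith
  have hnL : (0:ℝ) ≤ n * L := by positivity
  have h1 : ((s + t' + n * L : ℝ) : EReal) < T.tf :=
    lt_of_le_of_lt (by exact_mod_cast (by linarith)) htf
  refine (anti (s + t' + n * L) t (by linarith) (by linarith) htf).trans ?_
  rcases key n h1 with h2 | h2
  · exact h2
  · nlinarith [sq_nonneg ‖T.x (s + t' + n * L)‖]
lemma kl_of_phi {φ : ℝ → ℝ → ℝ} (hmono : ∀ t, Monotone fun r => φ r t) (hanti : ∀ r, Antitone (φ r))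
    (h0 : ∀ r t, 0 ≤ φ r t) (hle : ∀ r t, 0 ≤ r → φ r t ≤ r)
    (hlim : ∀ r, Tendsto (φ r) atTop (𝓝 0)) :
    ∃ β, ClassKL β ∧ ∀ r t, 0 ≤ r → φ r t ≤ β r t := by
  have hmul : ∀ r t, 0 ≤ r → Monotone fun u => φ (r * u) t := fun r t hr u v huv =>
    hmono t (mul_le_mul_of_nonneg_left huv hr)
  have hItg : ∀ r t a b, 0 ≤ r → IntervalIntegrable (fun u => φ (r * u) t) volume a b :=
    fun r t a b hr => (hmul r t hr).intervalIntegrable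
  have hlow : ∀ r t, 0 ≤ r → φ r t ≤ ∫ u in (1:ℝ)..2, φ (r * u) t := by
    intro r t hr
    have := intervalIntegral.integral_mono_on (by norm_num : (1:ℝ) ≤ 2) (μ := volume)
      (f := fun _ => φ r t) intervalIntegrable_const (hItg r t 1 2 hr)
      (fun u hu => hmono t (by nlinarith [hu.1]))
    rw [intervalIntegral.integral_const] at this
    norm_num at this; exact this
  have hupp : ∀ r t, 0 ≤ r → ∫ u in (1:ℝ)..2, φ (r * u) t ≤ φ (2 * r) t := by
    intro r t hr
    have := intervalIntegral.integral_mono_on (by norm_num : (1:ℝ) ≤ 2) (μ := volume)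
      (g := fun _ => φ (2 * r) t) (hItg r t 1 2 hr) intervalIntegrable_const
      (fun u hu => hmono t (by nlinarith [hu.2]))
    rw [intervalIntegral.integral_const] at this
    norm_num at this; exact this
  have hnn : ∀ r t, 0 ≤ r → 0 ≤ ∫ u in (1:ℝ)..2, φ (r * u) t := fun r t hr =>
    (h0 r t).trans (hlow r t hr)
  refine ⟨fun r t => (∫ u in (1:ℝ)..2, φ (r * u) t) + r * Real.exp (-t), ⟨?_, ?_⟩, ?_⟩
  · intro t ht
    refine ⟨⟨?_, ?_, ?_⟩, ?_⟩
    · have hΦ : Continuous fun x => ∫ v in (0:ℝ)..x, φ v t :=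
        intervalIntegral.continuous_primitive (fun a b => (hmono t).intervalIntegrable) 0
      intro r hr
      rcases (mem_Ici.1 hr).eq_or_lt with h | h
      · subst h
        have e0 : (∫ u in (1:ℝ)..2, φ (0 * u) t) + 0 * Real.exp (-t) = 0 := by
          have a := hupp 0 t le_rfl
          have b := hnn 0 t le_rfl
          have c := hle (2 * 0) t (by norm_num)
          linarith
        unfold ContinuousWithinAt
        beta_reduce
        rw [e0]
        have l1 : Tendsto (fun r : ℝ => 2 * r + r * Real.exp (-t)) (𝓝[Ici 0] 0) (𝓝 0) := by
          have : Continuous fun r : ℝ => 2 * r + r * Real.exp (-t) := by fun_prop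
          have := (this.tendsto 0).mono_left (nhdsWithin_le_nhds (s := Ici 0))
          simpa using this
        refine tendsto_of_tendsto_of_tendsto_of_le_of_le' tendsto_const_nhds l1 ?_ ?_
        · filter_upwards [self_mem_nhdsWithin] with r hr
          exact add_nonneg (hnn r t hr) (mul_nonneg hr (Real.exp_pos _).le)
        · filter_upwards [self_mem_nhdsWithin] with r hr
          have hr' : 0 ≤ r := hr
          have := (hupp r t hr').trans (hle (2 * r) t (by linarith))
          linarith
      · apply ContinuousAt.continuousWithinAt
        refine ContinuousAt.add ?_ (by fun_prop)
        have : (fun r => ∫ u in (1:ℝ)..2, φ (r * u) t) =ᶠ[𝓝 r] fun r =>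
            r⁻¹ * ((∫ v in (0:ℝ)..(r * 2), φ v t) - ∫ v in (0:ℝ)..(r * 1), φ v t) := by
          filter_upwards [lt_mem_nhds h] with r' hr'
          rw [intervalIntegral.integral_comp_mul_left (fun v => φ v t) hr'.ne', smul_eq_mul,
            intervalIntegral.integral_interval_sub_left (hmono t).intervalIntegrable
              (hmono t).intervalIntegrable]
        refine ContinuousAt.congr ?_ this.symm
        have c1 : Continuous fun r : ℝ => ∫ v in (0:ℝ)..(r * 2), φ v t :=
          hΦ.comp (continuous_id.mul continuous_const)
        have c2 : Continuous fun r : ℝ => ∫ v in (0:ℝ)..(r * 1), φ v t :=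
          hΦ.comp (continuous_id.mul continuous_const)
        exact (continuousAt_inv₀ h.ne').mul (c1.sub c2).continuousAt
    · intro r hr r' hr' hrr
      have hr : 0 ≤ r := hr
      have hr' : 0 ≤ r' := hr'
      have := intervalIntegral.integral_mono_on (by norm_num : (1:ℝ) ≤ 2)
        (hItg r t 1 2 hr) (hItg r' t 1 2 hr')
        (fun u hu => hmono t (mul_le_mul_of_nonneg_right hrr.le (by linarith [hu.1])))
      have := mul_lt_mul_of_pos_right hrr (Real.exp_pos (-t))
      simp only
      linarith
    · have a := hupp 0 t le_rfl
      have b := hnn 0 t le_rfl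
      have c := hle (2 * 0) t (by norm_num)
      simp only
      linarith
    · have l : Tendsto (fun r : ℝ => r * Real.exp (-t)) atTop atTop :=
        tendsto_id.atTop_mul_const (Real.exp_pos _)
      refine tendsto_atTop_mono' _ ?_ l
      filter_upwards [eventually_ge_atTop 0] with r hr
      have := hnn r t hr
      linarith
  · intro r hr
    refine ⟨?_, ?_⟩
    · intro t _ t' _ htt
      have h1 := intervalIntegral.integral_mono_on (by norm_num : (1:ℝ) ≤ 2)
        (hItg r t' 1 2 hr) (hItg r t 1 2 hr) (fun u hu => hanti (r * u) htt)
      have h2 := mul_le_mul_of_nonneg_left (Real.exp_le_exp.2 (neg_le_neg htt)) hr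
      simp only
      linarith
    · have l1 : Tendsto (fun t => ∫ u in (1:ℝ)..2, φ (r * u) t) atTop (𝓝 0) :=
        tendsto_of_tendsto_of_tendsto_of_le_of_le tendsto_const_nhds (hlim (2 * r))
          (fun t => hnn r t hr) (fun t => hupp r t hr)
      have l2 : Tendsto (fun t : ℝ => r * Real.exp (-t)) atTop (𝓝 0) := by
        simpa using (Real.tendsto_exp_neg_atTop_nhds_zero).const_mul r
      simpa using l1.add l2
  · intro r t hr
    have := hlow r t hr
    have := mul_nonneg hr (Real.exp_pos (-t)).le
    simp only
    linarith

/-- Set of reachable norms. -/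
def reach (f : ℝ → E 2 → Fin 3 → E 2) (r t : ℝ) : Set ℝ :=
  insert 0 {y | ∃ (T : Sol (univ : Set (E 2)) f) (s t' : ℝ), T.InDom s ∧ ‖T.x s‖ ≤ r ∧ t ≤ t' ∧
    0 ≤ t' ∧ ((s + t' : ℝ) : EReal) < T.tf ∧ y = ‖T.x (s + t')‖}

lemma guas_of {f : ℝ → E 2 → Fin 3 → E 2} {g₁ g₂ : ℝ → E 2 → ℝ} (hf : Modes g₁ g₂ f)
    (hatt : ∀ R ε : ℝ, 0 < R → 0 < ε → ∃ Tb : ℝ, ∀ T : Sol (univ : Set (E 2)) f, ∀ s, T.InDom s →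
      ‖T.x s‖ ≤ R → ∀ t, s + Tb ≤ t → (t : EReal) < T.tf → ‖T.x t‖ ≤ ε) :
    ∃ β, ClassKL β ∧ ∀ T : Sol (univ : Set (E 2)) f, ∀ s : ℝ, T.InDom s →
      ∀ t : ℝ, s ≤ t → (t : EReal) < T.tf → ‖T.x t‖ ≤ β ‖T.x s‖ (t - s) := by
  have hbd : ∀ r t, ∀ y ∈ reach f r t, y ≤ max r 0 := by
    rintro r t y (rfl | ⟨T, s, t', hs, hr, _, h0, htf, rfl⟩)
    · exact le_max_right _ _
    · have := (sq_le_sq₀ (norm_nonneg _) (norm_nonneg _)).1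
        (sol_antitone hf T hs.1 (by linarith : s ≤ s + t') htf)
      exact (this.trans hr).trans (le_max_left _ _)
  have hB : ∀ r t, BddAbove (reach f r t) := fun r t => ⟨_, hbd r t⟩
  have hne : ∀ r t, (reach f r t).Nonempty := fun r t => ⟨0, mem_insert _ _⟩
  have main : ∃ β, ClassKL β ∧ ∀ r t, 0 ≤ r → sSup (reach f r t) ≤ β r t := by
    refine kl_of_phi (φ := fun r t => sSup (reach f r t)) ?_ ?_ ?_ ?_ ?_
    · intro t r r' hrr
      refine csSup_le_csSup (hB _ _) (hne _ _) (insert_subset_insert ?_)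
      rintro y ⟨T, s, t', hs, hr, h⟩
      exact ⟨T, s, t', hs, hr.trans hrr, h⟩
    · intro r t1 t2 htt
      refine csSup_le_csSup (hB _ _) (hne _ _) (insert_subset_insert ?_)
      rintro y ⟨T, s, t', hs, hr, h, h'⟩
      exact ⟨T, s, t', hs, hr, htt.trans h, h'⟩
    · intro r t
      exact le_csSup (hB _ _) (mem_insert _ _)
    · intro r t hr
      exact csSup_le (hne _ _) fun y hy => (hbd r t y hy).trans (max_le le_rfl hr)
    · intro r
      rw [Metric.tendsto_atTop]
      intro ε hε
      obtain ⟨Tb, h⟩ := hatt (max r 1) (ε / 2) (by positivity) (half_pos hε)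
      refine ⟨Tb, fun t ht => ?_⟩
      rw [Real.dist_eq, sub_zero, abs_of_nonneg (le_csSup (hB _ _) (mem_insert _ _))]
      refine lt_of_le_of_lt (csSup_le (hne _ _) ?_) (half_lt_self hε)
      rintro y (rfl | ⟨T, s, t', hs, hr, htt, h0, htf, rfl⟩)
      · exact (half_pos hε).le
      · exact h T s hs (hr.trans (le_max_left _ _)) _ (by linarith) htf
  · obtain ⟨β, hβ, hφ⟩ := main
    refine ⟨β, hβ, fun T s hs t hst htf => le_trans ?_ (hφ _ _ (norm_nonneg _))⟩
    refine le_csSup (hB _ _) (mem_insert_of_mem _ ⟨T, s, t - s, hs, le_rfl, le_rfl, by linarith, ?_, ?_⟩)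
    · rwa [add_sub_cancel]
    · rw [add_sub_cancel]
/-- Example 1: GUAS under arbitrary switchings of the three-mode time-varying switched
system with modes f₁(t,ξ) = (−g₁ξ₂, g₁ξ₁ − ξ₂), f₂(t,ξ) = (g₂ξ₂ − ξ₁, −g₂ξ₁),
f₃(t,ξ) = (2g₂ξ₂ − ξ₁, −2g₂ξ₁), under the stated regularity and persistency-of-
excitation conditions on g₁, g₂. -/
theorem three_mode_example_guas_arbitrary_switching
    (g₁ g₂ : ℝ → E 2 → ℝ)
    (hg_bdd : UnifBounded (univ : Set (E 2)) g₁ ∧ UnifBounded (univ : Set (E 2)) g₂)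
    (hg_meas : (∀ ξ, Measurable fun t => g₁ t ξ) ∧ ∀ ξ, Measurable fun t => g₂ t ξ)
    (hg_cont : ContXiUnifT (univ : Set (E 2)) g₁ ∧ ContXiUnifT (univ : Set (E 2)) g₂)
    -- precompactness of ĝ₁(t,v) = g₁(t, v·e₁) and ĝ₂(t,v) = g₂(t, v·e₂)
    (hg_pre :
      Precompact (univ : Set ℝ)
        (fun t v => g₁ t ((WithLp.equiv 2 (Fin 2 → ℝ)).symm ![v, 0])) ∧
      Precompact (univ : Set ℝ)
        (fun t v => g₂ t ((WithLp.equiv 2 (Fin 2 → ℝ)).symm ![0, v])))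
    -- persistency-of-excitation conditions (4.2)
    (hPE₁ : ∀ v₀ : ℝ, v₀ ≠ 0 → ∃ T : ℝ, 0 < T ∧ ∃ r : ℝ, 0 < r ∧
      0 < atTop.liminf fun t : ℝ =>
        ∫ s in t..(t + T), |g₁ s ((WithLp.equiv 2 (Fin 2 → ℝ)).symm ![v₀, 0])| ^ r)
    (hPE₂ : ∀ v₀ : ℝ, v₀ ≠ 0 → ∃ T : ℝ, 0 < T ∧ ∃ r : ℝ, 0 < r ∧
      0 < atTop.liminf fun t : ℝ =>
        ∫ s in t..(t + T), |g₂ s ((WithLp.equiv 2 (Fin 2 → ℝ)).symm ![0, v₀])| ^ r)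
    (f : ℝ → E 2 → Fin 3 → E 2)
    (hf : ∀ (t : ℝ) (ξ : E 2),
      f t ξ 0 = (WithLp.equiv 2 (Fin 2 → ℝ)).symm
        ![-(g₁ t ξ * ξ 1), g₁ t ξ * ξ 0 - ξ 1] ∧
      f t ξ 1 = (WithLp.equiv 2 (Fin 2 → ℝ)).symm
        ![g₂ t ξ * ξ 1 - ξ 0, -(g₂ t ξ * ξ 0)] ∧
      f t ξ 2 = (WithLp.equiv 2 (Fin 2 → ℝ)).symm
        ![2 * g₂ t ξ * ξ 1 - ξ 0, -(2 * g₂ t ξ * ξ 0)]) :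
    GUAS {T : Sol (univ : Set (E 2)) f | T.IsMaximal} := by
  have hM : Modes g₁ g₂ f := by
    intro t ξ
    obtain ⟨h0, h1, h2⟩ := hf t ξ
    rw [h0, h1, h2]
    exact ⟨⟨rfl, rfl⟩, ⟨rfl, rfl⟩, rfl, rfl⟩
  refine ⟨rfl, ?_⟩
  obtain ⟨β, hβ, h⟩ := guas_of hM (fun R ε hR hε => attract hM hε
    (window hM
      (e₁ := fun p q => (WithLp.equiv 2 (Fin 2 → ℝ)).symm ![p, q])
      (e₂ := fun p q => (WithLp.equiv 2 (Fin 2 → ℝ)).symm ![q, p])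
      (by intro ξ; ext i; fin_cases i <;> rfl) (by intro ξ; ext i; fin_cases i <;> rfl)
      hg_bdd.1 hg_cont.1 hg_meas.1 hg_pre.1 hPE₁
      (by intro p q; rw [norm_sq2]; rfl)
      (by intro p q v w; ext i; fin_cases i <;> rfl)
      hg_bdd.2 hg_cont.2 hg_meas.2 hg_pre.2 hPE₂
      (by intro p q; rw [norm_sq2, add_comm]; rfl)
      (by intro p q v w; ext i; fin_cases i <;> rfl) hR hε))
  exact ⟨β, hβ, fun T _ => h T⟩
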